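/- arXiv:2110.14631 — 3 statements merged into one kernel-verified Lean document; each statement's English description precedes it below -/
import Mathlib

section
/- Let C ⊆ 𝔽₂^N be a binary linear code with BPSK image C_x ⊆ {±1}^N, let X be uniformly distributed on C_x, let Z be a real random vector independent of X with independent components, let Z' be an independent copy of Z (independent of (X,Z)), and set Y = X ⊙ Z and Y' = X ⊙ Z'. Then for every i ∈ {0,…,N−1} and S ⊆ {0,…,N−1}: mmse(X_i | Y_S)·(1 − mmse(X_i | Y_S)) = (1/2)·E[ ( E[X_i | Y_S] − E[X_i | Y'_S] )² ], where E[X_i | Y'_S] denotes the conditional expectation of X_i given the vector Y'_S. -/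
open MeasureTheory ProbabilityTheory

noncomputable section

/-- The binary entropy function (base 2). -/
def hb (p : ℝ) : ℝ := -(p * Real.logb 2 p) - (1 - p) * Real.logb 2 (1 - p)

/-- Conditional expectation `E[X | W]` of `X` given the σ-algebra generated by `W`. -/
def condMean {Ω β E : Type*} [MeasurableSpace Ω] [MeasurableSpace β]
    [NormedAddCommGroup E] [NormedSpace ℝ E] [CompleteSpace E]
    (μ : Measure Ω) (X : Ω → E) (W : Ω → β) : Ω → E :=
  μ[X | MeasurableSpace.comap W inferInstance]

/-- Bit-error probability of the MAP decision rule for `X ∈ {±1}` given `W`. -/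
def BER {Ω β : Type*} [MeasurableSpace Ω] [MeasurableSpace β]
    (μ : Measure Ω) (X : Ω → ℝ) (W : Ω → β) : ℝ :=
  (1 - ∫ ω, |condMean μ X W ω| ∂μ) / 2

/-- Minimum mean squared error of estimating `X` from `W`. -/
def mmse {Ω β : Type*} [MeasurableSpace Ω] [MeasurableSpace β]
    (μ : Measure Ω) (X : Ω → ℝ) (W : Ω → β) : ℝ :=
  ∫ ω, (X ω - condMean μ X W ω) ^ 2 ∂μ

/-- Uniform distribution on `{-1, 1} ⊆ ℝ`. -/
def signMeasure : Measure ℝ := (2 : ENNReal)⁻¹ • (Measure.dirac (-1) + Measure.dirac 1)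

/-- Capacity of the BMS channel (in multiplicative-noise form) with noise law `PZ`:
`C = 1 - E[h_b((1 + E[X_u | Y_u])/2)]` where `X_u` is uniform on `{±1}`, independent of
`Z₀ ~ PZ`, and `Y_u = X_u · Z₀`. -/
def capacity (PZ : Measure ℝ) : ℝ :=
  1 - ∫ p, hb ((1 + condMean (signMeasure.prod PZ)
        (fun q : ℝ × ℝ => q.1) (fun q : ℝ × ℝ => q.1 * q.2) p) / 2) ∂(signMeasure.prod PZ)

/-- Evaluation vector of the multilinear polynomial whose coefficients on monomials
of degree at most `r` are given by `α` (higher-degree coefficients being ignored),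
evaluated at the point `v ∈ 𝔽₂^m` with index `i = Σ_j v_j 2^j`. -/
def RMword (r m : ℕ) (α : Finset (Fin m) → ZMod 2) : Fin (2 ^ m) → ZMod 2 :=
  fun i => ∑ S ∈ Finset.univ.filter (fun S : Finset (Fin m) => S.card ≤ r),
    α S * ∏ j ∈ S, ((((i : ℕ) / 2 ^ (j : ℕ)) % 2 : ℕ) : ZMod 2)

/-- The Reed–Muller code RM(r, m) ⊆ 𝔽₂^{2^m}. -/
def RMcode (r m : ℕ) : Finset (Fin (2 ^ m) → ZMod 2) :=
  Finset.image (RMword r m) Finset.univ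

/-- The rate `R(r,m)` of RM(r,m). -/
def RMrate (r m : ℕ) : ℝ := (2 ^ m : ℝ)⁻¹ * ∑ i ∈ Finset.range (r + 1), (m.choose i : ℝ)

/-- BPSK modulation map `c ↦ ((-1)^{c_0}, …, (-1)^{c_{N-1}})`. -/
def bpsk {N : ℕ} (c : Fin N → ZMod 2) : Fin N → ℝ := fun i => (-1 : ℝ) ^ ((c i).val)

/-- BPSK image of a binary code. -/
def bpskImage {N : ℕ} (C : Finset (Fin N → ZMod 2)) : Finset (Fin N → ℝ) :=
  letI := Classical.decEq (Fin N → ℝ)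
  C.image bpsk

/-- BPSK image of RM(r,m). -/
def bpskRM (r m : ℕ) : Finset (Fin (2 ^ m) → ℝ) := bpskImage (RMcode r m)

/-- Uniform probability measure on a finite set. -/
def uniformOnFinset {α : Type*} [MeasurableSpace α] (s : Finset α) : Measure α :=
  (s.card : ENNReal)⁻¹ • ∑ x ∈ s, Measure.dirac x

/-- `ρ(m) = (6 ln m + 34)/(5 √m)`. -/
def rho (m : ℕ) : ℝ := (6 * Real.log m + 34) / (5 * Real.sqrt m)

/-- Inverse of the binary entropy function restricted to `[0, 1/2]`. -/
def hbInv (u : ℝ) : ℝ := sSup {p : ℝ | p ∈ Set.Icc (0 : ℝ) (1 / 2) ∧ hb p ≤ u}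

/-- `ψ(u) = 1 - (1 - 2 h_b^{-1}(u))²`. -/
def psi (u : ℝ) : ℝ := 1 - (1 - 2 * hbInv u) ^ 2

/-- `Ψ(u) = ∫₀^u ψ(v) dv`. -/
def PsiInt (u : ℝ) : ℝ := ∫ v in (0 : ℝ)..u, psi v

/-- The coefficients `c_k = 1/(ln 2 · 2k (2k-1))`. -/
def ck (k : ℕ) : ℝ := 1 / (Real.log 2 * (2 * k) * (2 * k - 1))

/-- The channel moments `q_k = E[(E[X_u | Y_u])^{2k}]` for uniform input. -/
def qmom (PZ : Measure ℝ) (k : ℕ) : ℝ :=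
  ∫ p, (condMean (signMeasure.prod PZ)
      (fun q : ℝ × ℝ => q.1) (fun q : ℝ × ℝ => q.1 * q.2) p) ^ (2 * k) ∂(signMeasure.prod PZ)

end

section helpers12

variable {N : ℕ}

/-- The observed vector. -/
def obs12 (S : Finset (Fin N)) (x z : Fin N → ℝ) : {x // x ∈ S} → ℝ := fun j => x j.1 * z j.1

lemma measurable_obs12 (S : Finset (Fin N)) :
    Measurable (fun p : (Fin N → ℝ) × (Fin N → ℝ) => obs12 S p.1 p.2) := by
  unfold obs12
  fun_prop

lemma measurable_obs12_right (S : Finset (Fin N)) (x : Fin N → ℝ) :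
    Measurable (fun z : (Fin N → ℝ) => obs12 S x z) := by
  unfold obs12
  fun_prop

lemma unif_prod12 {α W : Type*} [MeasurableSpace α] [MeasurableSpace W]
    (B : Finset α) (κ : Measure W) [IsProbabilityMeasure κ] :
    (uniformOnFinset B).prod κ
      = (B.card : ENNReal)⁻¹ • ∑ x ∈ B, Measure.map (Prod.mk x) κ := by
  classical
  unfold uniformOnFinset
  rw [Measure.prod_smul_left]
  congr 1
  induction B using Finset.induction_on with
  | empty => simp
  | insert a s ha ih =>
    rw [Finset.sum_insert ha, Finset.sum_insert ha, Measure.add_prod, ih, Measure.dirac_prod]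

lemma unif_int12 {α W : Type*} [MeasurableSpace α] [MeasurableSpace W]
    (B : Finset α) (hB : B.Nonempty) (κ : Measure W) [IsProbabilityMeasure κ] (h : α × W → ℝ)
    (hm : Measurable h) (K : ℝ) (hK : ∀ x ∈ B, ∀ w, |h (x, w)| ≤ K) :
    Integrable h ((uniformOnFinset B).prod κ) ∧
    ∫ p, h p ∂((uniformOnFinset B).prod κ) = (B.card : ℝ)⁻¹ * ∑ x ∈ B, ∫ w, h (x, w) ∂κ := by
  have hi : ∀ x ∈ B, Integrable h (Measure.map (Prod.mk x) κ) := by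
    intro x hx
    rw [integrable_map_measure hm.aestronglyMeasurable measurable_prodMk_left.aemeasurable]
    refine Integrable.of_bound (C := K) (hm.comp measurable_prodMk_left).aestronglyMeasurable ?_
    exact Filter.Eventually.of_forall fun w => hK x hx w
  rw [unif_prod12]
  constructor
  · refine Integrable.smul_measure (integrable_finsetSum_measure.2 hi) ?_
    simpa using hB.ne_empty
  · rw [integral_smul_measure, integral_finsetSum_measure hi]
    simp only [ENNReal.toReal_inv, ENNReal.toReal_natCast, smul_eq_mul]
    congr 1
    refine Finset.sum_congr rfl fun x hx => ?_
    rw [integral_map measurable_prodMk_left.aemeasurable hm.aestronglyMeasurable]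

lemma unif_prob12 {α : Type*} [MeasurableSpace α] (B : Finset α) (hB : B.Nonempty) :
    IsProbabilityMeasure (uniformOnFinset B) := by
  constructor
  unfold uniformOnFinset
  simp only [Measure.smul_apply, Measure.coe_finsetSum, Finset.sum_apply, measure_univ,
    Finset.sum_const, nsmul_eq_mul, mul_one, smul_eq_mul]
  exact ENNReal.inv_mul_cancel (by simpa using hB.ne_empty) (by simp)

/-- Sign group properties of the BPSK image. -/
structure SignGroup12 (B : Finset (Fin N → ℝ)) : Prop where
  one_mem : (1 : Fin N → ℝ) ∈ B
  mul_mem : ∀ x ∈ B, ∀ y ∈ B, x * y ∈ B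
  sq : ∀ x ∈ B, ∀ j, x j * x j = 1

lemma SignGroup12.abs_eq {B : Finset (Fin N → ℝ)} (h : SignGroup12 B) {x : Fin N → ℝ}
    (hx : x ∈ B) (j : Fin N) : |x j| = 1 := by
  have := h.sq x hx j
  rw [_root_.abs_eq (by norm_num)]
  exact mul_self_eq_one_iff.1 this

lemma SignGroup12.sum_shift {B : Finset (Fin N → ℝ)} (h : SignGroup12 B) {c : Fin N → ℝ}
    (hc : c ∈ B) (G : (Fin N → ℝ) → ℝ) : ∑ x ∈ B, G (c * x) = ∑ x ∈ B, G x := by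
  have hcc : ∀ x : Fin N → ℝ, c * (c * x) = x := by
    intro x
    ext j
    simp only [Pi.mul_apply]
    rw [← mul_assoc, h.sq c hc j, one_mul]
  refine Finset.sum_bij' (fun x _ => c * x) (fun x _ => c * x) ?_ ?_ ?_ ?_ ?_
  · intro x hx; exact h.mul_mem c hc x hx
  · intro x hx; exact h.mul_mem c hc x hx
  · intro x _; exact hcc x
  · intro x _; exact hcc x
  · intro x _; rfl

lemma obs12_mul (S : Finset (Fin N)) (c x z : Fin N → ℝ) :
    obs12 S (c * x) z = fun j => c j.1 * obs12 S x z j := by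
  ext j
  simp [obs12, mul_assoc]

lemma signGroup_bpsk12 (C : Finset (Fin N → ZMod 2)) (h0 : (0 : Fin N → ZMod 2) ∈ C)
    (hadd : ∀ u ∈ C, ∀ v ∈ C, u + v ∈ C) : SignGroup12 (bpskImage C) := by
  have hmem : ∀ x, x ∈ bpskImage C ↔ ∃ c ∈ C, bpsk c = x := by
    intro x
    unfold bpskImage
    exact @Finset.mem_image _ _ (Classical.decEq _) _ _ _
  have h2 : ∀ a b : ZMod 2, (-1 : ℝ) ^ ((a + b).val) = (-1) ^ a.val * (-1) ^ b.val := by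
    intro a b
    rw [ZMod.val_add, ← pow_add, neg_one_pow_eq_pow_mod_two (n := a.val + b.val)]
  refine ⟨?_, ?_, ?_⟩
  · rw [hmem]
    refine ⟨0, h0, ?_⟩
    ext j
    simp [bpsk]
  · intro x hx y hy
    rw [hmem] at *
    obtain ⟨u, hu, rfl⟩ := hx
    obtain ⟨v, hv, rfl⟩ := hy
    refine ⟨u + v, hadd u hu v hv, ?_⟩
    ext j
    exact h2 _ _
  · intro x hx j
    rw [hmem] at hx
    obtain ⟨u, hu, rfl⟩ := hx
    unfold bpsk
    rw [← mul_pow]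
    simp

/-- Existence of an exactly equivariant version of the conditional mean. -/
lemma exists_F12 (B : Finset (Fin N → ℝ)) (hB : SignGroup12 B) (ρ : Measure (Fin N → ℝ))
    [IsProbabilityMeasure ρ] (i : Fin N) (S : Finset (Fin N)) :
    ∃ F : ({x // x ∈ S} → ℝ) → ℝ, Measurable F ∧ (∀ y, |F y| ≤ 1) ∧
      (∀ c ∈ B, ∀ y, F (fun j => c j.1 * y j) = c i * F y) ∧
      ∀ t : Set ({x // x ∈ S} → ℝ), MeasurableSet t →
        ∑ x ∈ B, ∫ z, t.indicator 1 (obs12 S x z) * F (obs12 S x z) ∂ρ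
          = ∑ x ∈ B, ∫ z, t.indicator 1 (obs12 S x z) * x i ∂ρ := by
  have hne : B.Nonempty := ⟨1, hB.one_mem⟩
  have hcard : (B.card : ℝ) ≠ 0 := by simpa using hne.ne_empty
  have hind : ∀ (t : Set ({x // x ∈ S} → ℝ)), MeasurableSet t →
      Measurable (t.indicator (1 : ({x // x ∈ S} → ℝ) → ℝ)) := fun t ht =>
    measurable_one.indicator ht
  have hind1 : ∀ (t : Set ({x // x ∈ S} → ℝ)) y,
      |t.indicator (1 : ({x // x ∈ S} → ℝ) → ℝ) y| ≤ 1 := by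
    intro t y
    by_cases hy : y ∈ t <;> simp [hy]
  -- a first version
  obtain ⟨f, hfm, hf1, hf⟩ : ∃ f : ({x // x ∈ S} → ℝ) → ℝ, Measurable f ∧ (∀ y, |f y| ≤ 1) ∧
      ∀ t : Set ({x // x ∈ S} → ℝ), MeasurableSet t →
        ∑ x ∈ B, ∫ z, t.indicator 1 (obs12 S x z) * f (obs12 S x z) ∂ρ
          = ∑ x ∈ B, ∫ z, t.indicator 1 (obs12 S x z) * x i ∂ρ := by
    haveI := unif_prob12 B hne
    set P := (uniformOnFinset B).prod ρ with hP
    let Y : (Fin N → ℝ) × (Fin N → ℝ) → ({x // x ∈ S} → ℝ) := fun p => obs12 S p.1 p.2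
    have hY : Measurable Y := measurable_obs12 S
    let U : (Fin N → ℝ) × (Fin N → ℝ) → ℝ := fun p => p.1 i
    have hUm : Measurable U := by fun_prop
    have hUi : Integrable U P :=
      (unif_int12 B hne ρ U hUm 1 (fun x hx w => (hB.abs_eq hx i).le)).1
    have hU1 : ∀ᵐ p ∂P, |U p| ≤ ((1 : NNReal) : ℝ) := by
      have h1 := (unif_int12 B hne ρ (fun p => if |U p| ≤ 1 then 0 else 1)
        (Measurable.ite (measurableSet_le (by fun_prop) (by fun_prop)) measurable_const measurable_const) 1
        (fun x hx w => by simp [U, hB.abs_eq hx i]))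
      have h2 : ∫ p, (if |U p| ≤ 1 then (0:ℝ) else 1) ∂P = 0 := by
        rw [h1.2]
        rw [Finset.sum_eq_zero, mul_zero]
        intro x hx
        simp [U, hB.abs_eq hx i]
      rw [integral_eq_zero_iff_of_nonneg (fun p => by dsimp only [Pi.zero_apply]; split_ifs <;> norm_num) h1.1] at h2
      filter_upwards [h2] with p hp
      by_contra hcon
      simp only [NNReal.coe_one] at hcon
      simp [hcon] at hp
    have hm : MeasurableSpace.comap Y inferInstance ≤ (inferInstance : MeasurableSpace _) :=
      hY.comap_le
    obtain ⟨f0, hf0, hf0e⟩ := (stronglyMeasurable_condExp (μ := P) (f := U)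
      (m := MeasurableSpace.comap Y inferInstance)).measurable.exists_eq_measurable_comp
    have hbd := ae_bdd_condExp_of_ae_bdd (m := MeasurableSpace.comap Y inferInstance) hU1
    refine ⟨fun y => max (-1) (min 1 (f0 y)), by fun_prop, ?_, ?_⟩
    · intro y
      rw [abs_le]
      exact ⟨le_max_left _ _, max_le (by norm_num) (min_le_left _ _)⟩
    · intro t ht
      have hae : ∀ᵐ p ∂P, max (-1) (min 1 (f0 (Y p))) = (P[U | MeasurableSpace.comap Y inferInstance]) p := by
        filter_upwards [hbd] with p hp
        rw [hf0e] at hp ⊢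
        simp only [NNReal.coe_one, Function.comp_apply] at hp ⊢
        rw [abs_le] at hp
        rw [min_eq_right hp.2, max_eq_right hp.1]
      have e1 := (unif_int12 B hne ρ
        (fun p => t.indicator 1 (Y p) * max (-1) (min 1 (f0 (Y p))))
        (((hind t ht).comp hY).mul (by fun_prop)) 1 (by
          intro x hx w
          rw [abs_mul]
          refine mul_le_one₀ (hind1 _ _) (abs_nonneg _) ?_
          rw [abs_le]
          exact ⟨le_max_left _ _, max_le (by norm_num) (min_le_left _ _)⟩)).2
      have e2 := (unif_int12 B hne ρ
        (fun p => t.indicator 1 (Y p) * U p)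
        (((hind t ht).comp hY).mul (by fun_prop)) 1 (by
          intro x hx w
          rw [abs_mul]
          exact mul_le_one₀ (hind1 _ _) (abs_nonneg _) (hB.abs_eq hx i).le)).2
      have hset : MeasurableSet[MeasurableSpace.comap Y inferInstance] (Y ⁻¹' t) := ⟨t, ht, rfl⟩
      have hconv : ∀ G : (Fin N → ℝ) × (Fin N → ℝ) → ℝ,
          ∫ p, t.indicator 1 (Y p) * G p ∂P = ∫ p in Y ⁻¹' t, G p ∂P := by
        intro G
        rw [← integral_indicator (hY ht)]
        congr 1
        ext p
        by_cases hp : Y p ∈ t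
        · simp [hp]
        · simp [hp]
      have e3 : ∫ p, t.indicator 1 (Y p) * max (-1) (min 1 (f0 (Y p))) ∂P
          = ∫ p, t.indicator 1 (Y p) * U p ∂P := by
        rw [hconv U, ← setIntegral_condExp hm hUi hset, ← hconv]
        refine integral_congr_ae ?_
        filter_upwards [hae] with p hp
        rw [hp]
      rw [e1, e2] at e3
      exact mul_left_cancel₀ (inv_ne_zero hcard) e3
  -- symmetrize
  have hcm : ∀ c : Fin N → ℝ, Measurable (fun y : {x // x ∈ S} → ℝ => (fun j => c j.1 * y j : {x // x ∈ S} → ℝ)) := by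
    intro c
    fun_prop
  refine ⟨fun y => (B.card : ℝ)⁻¹ * ∑ c ∈ B, c i * f (fun j => c j.1 * y j), ?_, ?_, ?_, ?_⟩
  · refine Measurable.const_mul ?_ _
    refine Finset.measurable_sum _ fun c _ => ?_
    exact (hfm.comp (hcm c)).const_mul _
  · intro y
    rw [abs_mul, abs_inv, Nat.abs_cast, inv_mul_le_iff₀ (by positivity), mul_one]
    refine (Finset.abs_sum_le_sum_abs _ _).trans ?_
    have : ∀ c ∈ B, |c i * f (fun j => c j.1 * y j)| ≤ 1 := by
      intro c hc
      rw [abs_mul, hB.abs_eq hc, one_mul]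
      exact hf1 _
    simpa using Finset.sum_le_sum this
  · intro c hc y
    have := hB.sum_shift hc (fun d => d i * f (fun j => d j.1 * y j))
    dsimp only
    rw [← this, mul_left_comm, Finset.mul_sum, Finset.mul_sum, Finset.mul_sum]
    refine Finset.sum_congr rfl fun d _ => ?_
    have e : (fun j : {x // x ∈ S} => (c * d) j.1 * y j) = fun j => d j.1 * (c j.1 * y j) := by
      ext j; simp only [Pi.mul_apply]; ring
    rw [e]
    have := hB.sq c hc i
    simp only [Pi.mul_apply]
    linear_combination (-(B.card : ℝ)⁻¹ * d i * f (fun j => d j.1 * (c j.1 * y j))) * this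
  · intro t ht
    have hint : ∀ x c : Fin N → ℝ, c ∈ B → Integrable (fun z => t.indicator 1 (obs12 S x z) *
        (c i * f (fun j => c j.1 * obs12 S x z j))) ρ := by
      intro x c hc
      refine Integrable.of_bound (C := 1) ?_ ?_
      · exact (((hind t ht).comp (measurable_obs12_right S x)).mul
          ((hfm.comp ((hcm c).comp (measurable_obs12_right S x))).const_mul _)).aestronglyMeasurable
      · refine Filter.Eventually.of_forall fun z => ?_
        rw [Real.norm_eq_abs, abs_mul, abs_mul, hB.abs_eq hc, one_mul]
        exact mul_le_one₀ (hind1 _ _) (abs_nonneg _) (hf1 _)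
    have key : ∀ c ∈ B, ∑ x ∈ B, ∫ z, t.indicator 1 (obs12 S x z) *
        (c i * f (fun j => c j.1 * obs12 S x z j)) ∂ρ
        = ∑ x ∈ B, ∫ z, t.indicator 1 (obs12 S x z) * x i ∂ρ := by
      intro c hc
      let t' : Set ({x // x ∈ S} → ℝ) := (fun y => (fun j => c j.1 * y j : {x // x ∈ S} → ℝ)) ⁻¹' t
      have ht' : MeasurableSet t' := hcm c ht
      have hti : ∀ y : {x // x ∈ S} → ℝ, t'.indicator (1 : ({x // x ∈ S} → ℝ) → ℝ) y
          = t.indicator (1 : ({x // x ∈ S} → ℝ) → ℝ) (fun j => c j.1 * y j) := fun y => rfl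
      have h3 := hf t' ht'
      rw [← hB.sum_shift hc, ← hB.sum_shift hc (fun x => ∫ z, t.indicator 1 (obs12 S x z) * x i ∂ρ)]
      simp only [hti] at h3
      have h4 := congrArg (fun r => c i * r) h3
      simp only [Finset.mul_sum, ← integral_const_mul] at h4
      refine Eq.trans (Finset.sum_congr rfl fun x _ => integral_congr_ae
        (Filter.Eventually.of_forall fun z => ?_)) (h4.trans (Finset.sum_congr rfl fun x _ =>
          integral_congr_ae (Filter.Eventually.of_forall fun z => ?_)))
      · dsimp only
        rw [obs12_mul]
        have e : (fun j : {x // x ∈ S} => c j.1 * (c j.1 * obs12 S x z j)) = obs12 S x z := by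
          ext j
          rw [← mul_assoc, hB.sq c hc, one_mul]
        rw [e]
        ring
      · dsimp only
        rw [obs12_mul]
        simp only [Pi.mul_apply]
        ring
    have hexp : ∀ x ∈ B, ∫ z, t.indicator 1 (obs12 S x z) *
        ((B.card : ℝ)⁻¹ * ∑ c ∈ B, c i * f (fun j => c j.1 * obs12 S x z j)) ∂ρ
        = (B.card : ℝ)⁻¹ * ∑ c ∈ B, ∫ z, t.indicator 1 (obs12 S x z) *
          (c i * f (fun j => c j.1 * obs12 S x z j)) ∂ρ := by
      intro x _
      rw [← integral_finsetSum _ (fun c hc => hint x c hc), ← integral_const_mul]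
      congr 1
      ext z
      rw [← Finset.mul_sum]
      ring
    rw [Finset.sum_congr rfl hexp, ← Finset.mul_sum, Finset.sum_comm, Finset.sum_congr rfl key,
      Finset.sum_const, nsmul_eq_mul, ← mul_assoc, inv_mul_cancel₀ hcard, one_mul]

/-- The equivariant function is a version of the conditional mean for each channel use. -/
lemma condMean_eq12 {Ω : Type*} [MeasurableSpace Ω] (μ : Measure Ω) [IsProbabilityMeasure μ]
    (B : Finset (Fin N → ℝ)) (hB : SignGroup12 B) (ρ : Measure (Fin N → ℝ))
    [IsProbabilityMeasure ρ] (i : Fin N) (S : Finset (Fin N))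
    (F : ({x // x ∈ S} → ℝ) → ℝ) (hFm : Measurable F) (hF1 : ∀ y, |F y| ≤ 1)
    (hFs : ∀ c ∈ B, ∀ y, F (fun j => c j.1 * y j) = c i * F y)
    (hF : ∀ t : Set ({x // x ∈ S} → ℝ), MeasurableSet t →
        ∑ x ∈ B, ∫ z, t.indicator 1 (obs12 S x z) * F (obs12 S x z) ∂ρ
          = ∑ x ∈ B, ∫ z, t.indicator 1 (obs12 S x z) * x i ∂ρ)
    (X Z : Ω → (Fin N → ℝ)) (hX : Measurable X) (hZ : Measurable Z)
    (hlaw : Measure.map (fun ω => (X ω, Z ω)) μ = (uniformOnFinset B).prod ρ) :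
    Integrable (fun ω => X ω i) μ ∧
    (F ∘ (fun ω => obs12 S (X ω) (Z ω)) =ᵐ[μ]
      condMean μ (fun ω => X ω i) (fun ω => obs12 S (X ω) (Z ω))) ∧
    ∫ ω, X ω i * F (obs12 S (X ω) (Z ω)) ∂μ = ∫ z, F (obs12 S 1 z) ∂ρ ∧
    ∫ ω, F (obs12 S (X ω) (Z ω)) ^ 2 ∂μ = ∫ z, F (obs12 S 1 z) ∂ρ ∧
    ∫ ω, X ω i ^ 2 ∂μ = 1 ∧ Integrable (fun ω => X ω i ^ 2) μ ∧
    Integrable (fun ω => X ω i * F (obs12 S (X ω) (Z ω))) μ := by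
  have hne : B.Nonempty := ⟨1, hB.one_mem⟩
  have hcard : (B.card : ℝ) ≠ 0 := by simpa using hne.ne_empty
  have hXZ : Measurable (fun ω => (X ω, Z ω)) := hX.prodMk hZ
  have hY : Measurable (fun ω => obs12 S (X ω) (Z ω)) := (measurable_obs12 S).comp hXZ
  have tr : ∀ (h : (Fin N → ℝ) × (Fin N → ℝ) → ℝ) (hm : Measurable h) (K : ℝ)
      (hK : ∀ x ∈ B, ∀ w, |h (x, w)| ≤ K), Integrable (fun ω => h (X ω, Z ω)) μ ∧
      ∫ ω, h (X ω, Z ω) ∂μ = (B.card : ℝ)⁻¹ * ∑ x ∈ B, ∫ w, h (x, w) ∂ρ := by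
    intro h hm K hK
    have := unif_int12 B hne ρ h hm K hK
    rw [← hlaw] at this
    rw [integrable_map_measure hm.aestronglyMeasurable hXZ.aemeasurable,
      integral_map hXZ.aemeasurable hm.aestronglyMeasurable] at this
    exact this
  have hXi : Integrable (fun ω => X ω i) μ :=
    (tr (fun p => p.1 i) (by fun_prop) 1 (fun x hx w => (hB.abs_eq hx i).le)).1
  have hFY : Measurable (fun p : (Fin N → ℝ) × (Fin N → ℝ) => F (obs12 S p.1 p.2)) :=
    hFm.comp (measurable_obs12 S)
  have hFi : Integrable (F ∘ (fun ω => obs12 S (X ω) (Z ω))) μ :=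
    (tr (fun p => F (obs12 S p.1 p.2)) hFY 1 (fun x hx w => hF1 _)).1
  have hXF := tr (fun p => p.1 i * F (obs12 S p.1 p.2))
    ((by fun_prop : Measurable (fun p : (Fin N → ℝ) × (Fin N → ℝ) => p.1 i)).mul hFY) 1
    (fun x hx w => by rw [abs_mul, hB.abs_eq hx, one_mul]; exact hF1 _)
  have hXX := tr (fun p => p.1 i ^ 2) (by fun_prop) 1
    (fun x hx w => by rw [abs_pow, hB.abs_eq hx, one_pow])
  have hce : F ∘ (fun ω => obs12 S (X ω) (Z ω)) =ᵐ[μ]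
      condMean μ (fun ω => X ω i) (fun ω => obs12 S (X ω) (Z ω)) := by
    unfold condMean
    refine ae_eq_condExp_of_forall_setIntegral_eq hY.comap_le hXi ?_ ?_ ?_
    · intro s _ _
      exact hFi.integrableOn
    · rintro s ⟨t, ht, rfl⟩ _
      have hconv : ∀ G : Ω → ℝ,
          ∫ ω in (fun ω => obs12 S (X ω) (Z ω)) ⁻¹' t, G ω ∂μ
            = ∫ ω, t.indicator 1 (obs12 S (X ω) (Z ω)) * G ω ∂μ := by
        intro G
        rw [← integral_indicator (hY ht)]
        congr 1
        ext p
        by_cases hp : obs12 S (X p) (Z p) ∈ t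
        · simp [hp]
        · simp [hp]
      have hind1 : ∀ y, |t.indicator (1 : ({x // x ∈ S} → ℝ) → ℝ) y| ≤ 1 := by
        intro y
        by_cases hy : y ∈ t <;> simp [hy]
      have him : Measurable (fun p : (Fin N → ℝ) × (Fin N → ℝ) =>
          t.indicator (1 : ({x // x ∈ S} → ℝ) → ℝ) (obs12 S p.1 p.2)) :=
        (measurable_one.indicator ht).comp (measurable_obs12 S)
      rw [hconv, hconv]
      have e1 := (tr (fun p => t.indicator 1 (obs12 S p.1 p.2) * F (obs12 S p.1 p.2))
        (him.mul hFY) 1 (fun x hx w => by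
          rw [abs_mul]; exact mul_le_one₀ (hind1 _) (abs_nonneg _) (hF1 _))).2
      have e2 := (tr (fun p => t.indicator 1 (obs12 S p.1 p.2) * p.1 i)
        (him.mul (by fun_prop)) 1 (fun x hx w => by
          rw [abs_mul]; exact mul_le_one₀ (hind1 _) (abs_nonneg _) (hB.abs_eq hx i).le)).2
      simp only [Function.comp_apply]
      rw [e1, e2, hF t ht]
    · exact (hFm.comp (comap_measurable _)).stronglyMeasurable.aestronglyMeasurable
  have hq : ∫ ω, X ω i * F (obs12 S (X ω) (Z ω)) ∂μ = ∫ z, F (obs12 S 1 z) ∂ρ := by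
    rw [hXF.2]
    have : ∀ x ∈ B, ∫ w, x i * F (obs12 S x w) ∂ρ = ∫ z, F (obs12 S 1 z) ∂ρ := by
      intro x hx
      congr 1
      ext z
      have e := obs12_mul S x 1 z
      rw [mul_one] at e
      rw [e, hFs x hx, ← mul_assoc, hB.sq x hx, one_mul]
    rw [Finset.sum_congr rfl this, Finset.sum_const, nsmul_eq_mul, ← mul_assoc,
      inv_mul_cancel₀ hcard, one_mul]
  refine ⟨hXi, hce, hq, ?_, ?_, hXX.1, hXF.1⟩
  · rw [← hq]
    have hsm : StronglyMeasurable[MeasurableSpace.comap (fun ω => obs12 S (X ω) (Z ω)) inferInstance]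
        (F ∘ (fun ω => obs12 S (X ω) (Z ω))) :=
      (hFm.comp (comap_measurable _)).stronglyMeasurable
    have hi2 : Integrable ((F ∘ (fun ω => obs12 S (X ω) (Z ω))) * (fun ω => X ω i)) μ := by
      refine hXF.1.congr (Filter.Eventually.of_forall fun ω => ?_)
      simp [mul_comm]
    have hpull := condExp_mul_of_stronglyMeasurable_left hsm hi2 hXi
    have e := integral_condExp (μ := μ) (f := (F ∘ (fun ω => obs12 S (X ω) (Z ω))) * (fun ω => X ω i)) hY.comap_le
    rw [integral_congr_ae hpull] at e
    have e5 : ∫ ω, X ω i * F (obs12 S (X ω) (Z ω)) ∂μ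
        = ∫ ω, ((F ∘ (fun ω => obs12 S (X ω) (Z ω))) * (fun ω => X ω i)) ω ∂μ := by
      congr 1
      ext ω
      simp [mul_comm]
    rw [e5, ← e]
    refine integral_congr_ae ?_
    filter_upwards [hce] with ω hω
    unfold condMean at hω
    rw [Pi.mul_apply, ← hω]
    simp [sq]
  · rw [hXX.2]
    have : ∀ x ∈ B, ∫ w : Fin N → ℝ, x i ^ 2 ∂ρ = 1 := by
      intro x hx
      rw [sq, hB.sq x hx]
      simp
    rw [Finset.sum_congr rfl this]
    simp [hcard]

end helpers12

/-- For a binary linear code on a BMS channel with two independent channel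
uses `Y = X ⊙ Z` and `Y' = X ⊙ Z'` with the same input,
`mmse(X_i|Y_S)(1 − mmse(X_i|Y_S)) = ½ E[(E[X_i|Y_S] − E[X_i|Y'_S])²]`. -/
theorem stmt_12 {Ω : Type*} [MeasurableSpace Ω] (μ : Measure Ω) [IsProbabilityMeasure μ]
    (N : ℕ) (C : Finset (Fin N → ZMod 2))
    (h0 : (0 : Fin N → ZMod 2) ∈ C)
    (hadd : ∀ u ∈ C, ∀ v ∈ C, u + v ∈ C)
    (X Z Z' : Ω → (Fin N → ℝ))
    (hX : Measurable X) (hZ : Measurable Z) (hZ' : Measurable Z')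
    (ν : Fin N → Measure ℝ) (hν : ∀ i, ν i = Measure.map (fun ω => Z ω i) μ)
    (hlaw : Measure.map (fun ω => (X ω, Z ω, Z' ω)) μ
        = (uniformOnFinset (bpskImage C)).prod ((Measure.pi ν).prod (Measure.pi ν)))
    (i : Fin N) (S : Finset (Fin N)) :
    mmse μ (fun ω => X ω i)
        (fun ω => fun j : {x // x ∈ S} => X ω j.1 * Z ω j.1)
      * (1 - mmse μ (fun ω => X ω i)
          (fun ω => fun j : {x // x ∈ S} => X ω j.1 * Z ω j.1))
    = (1 / 2) * ∫ ω,
        (condMean μ (fun ω' => X ω' i)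
            (fun ω' => fun j : {x // x ∈ S} => X ω' j.1 * Z ω' j.1) ω
          - condMean μ (fun ω' => X ω' i)
            (fun ω' => fun j : {x // x ∈ S} => X ω' j.1 * Z' ω' j.1) ω) ^ 2 ∂μ := by
  have hB := signGroup_bpsk12 C h0 hadd
  set B := bpskImage C with hBdef
  have hne : B.Nonempty := ⟨1, hB.one_mem⟩
  have hcard : (B.card : ℝ) ≠ 0 := by simpa using hne.ne_empty
  haveI := unif_prob12 B hne
  haveI hνp : ∀ j, IsProbabilityMeasure (ν j) := by
    intro j
    rw [hν j]
    exact Measure.isProbabilityMeasure_map (by fun_prop)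
  set ρ := Measure.pi ν with hρ
  have hT : Measurable (fun ω => (X ω, Z ω, Z' ω)) := hX.prodMk (hZ.prodMk hZ')
  have hl1 : Measure.map (fun ω => (X ω, Z ω)) μ = (uniformOnFinset B).prod ρ := by
    have e : (fun ω => (X ω, Z ω)) = (Prod.map id Prod.fst) ∘ (fun ω => (X ω, Z ω, Z' ω)) := rfl
    rw [e, ← Measure.map_map (by fun_prop) hT, hlaw,
      ← Measure.map_prod_map _ _ measurable_id measurable_fst, Measure.map_id,
      Measure.map_fst_prod]
    simp
  have hl2 : Measure.map (fun ω => (X ω, Z' ω)) μ = (uniformOnFinset B).prod ρ := by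
    have e : (fun ω => (X ω, Z' ω)) = (Prod.map id Prod.snd) ∘ (fun ω => (X ω, Z ω, Z' ω)) := rfl
    rw [e, ← Measure.map_map (by fun_prop) hT, hlaw,
      ← Measure.map_prod_map _ _ measurable_id measurable_snd, Measure.map_id,
      Measure.map_snd_prod]
    simp
  obtain ⟨F, hFm, hF1, hFs, hF⟩ := exists_F12 B hB ρ i S
  obtain ⟨hXi, hc1, hq1, hs1, hx1, hxi, hxF⟩ :=
    condMean_eq12 μ B hB ρ i S F hFm hF1 hFs hF X Z hX hZ hl1
  obtain ⟨-, hc2, -, hs2, -, -, -⟩ :=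
    condMean_eq12 μ B hB ρ i S F hFm hF1 hFs hF X Z' hX hZ' hl2
  have hY1 : Measurable (fun ω => F (obs12 S (X ω) (Z ω))) :=
    hFm.comp ((measurable_obs12 S).comp (hX.prodMk hZ))
  have hY2 : Measurable (fun ω => F (obs12 S (X ω) (Z' ω))) :=
    hFm.comp ((measurable_obs12 S).comp (hX.prodMk hZ'))
  have hi : ∀ G : Ω → ℝ, Measurable G → (∀ ω, |G ω| ≤ 1) → Integrable G μ := fun G hG h1 =>
    Integrable.of_bound (C := 1) hG.aestronglyMeasurable (Filter.Eventually.of_forall h1)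
  have i1 : Integrable (fun ω => F (obs12 S (X ω) (Z ω)) ^ 2) μ :=
    hi _ (hY1.pow_const 2) fun ω => by rw [abs_pow]; exact pow_le_one₀ (abs_nonneg _) (hF1 _)
  have i2 : Integrable (fun ω => F (obs12 S (X ω) (Z' ω)) ^ 2) μ :=
    hi _ (hY2.pow_const 2) fun ω => by rw [abs_pow]; exact pow_le_one₀ (abs_nonneg _) (hF1 _)
  have i3 : Integrable (fun ω => F (obs12 S (X ω) (Z ω)) * F (obs12 S (X ω) (Z' ω))) μ :=
    hi _ (hY1.mul hY2) fun ω => by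
      rw [abs_mul]; exact mul_le_one₀ (hF1 _) (abs_nonneg _) (hF1 _)
  set g := ∫ z, F (obs12 S 1 z) ∂ρ with hg
  have hcross : ∫ ω, F (obs12 S (X ω) (Z ω)) * F (obs12 S (X ω) (Z' ω)) ∂μ = g ^ 2 := by
    have hm : Measurable (fun p : (Fin N → ℝ) × ((Fin N → ℝ) × (Fin N → ℝ)) =>
        F (obs12 S p.1 p.2.1) * F (obs12 S p.1 p.2.2)) := by
      refine (hFm.comp ?_).mul (hFm.comp ?_)
      · exact (measurable_obs12 S).comp (measurable_fst.prodMk (measurable_fst.comp measurable_snd))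
      · exact (measurable_obs12 S).comp (measurable_fst.prodMk (measurable_snd.comp measurable_snd))
    have e := (unif_int12 B hne (ρ.prod ρ) _ hm 1 (fun x hx w => by
      rw [abs_mul]; exact mul_le_one₀ (hF1 _) (abs_nonneg _) (hF1 _))).2
    rw [← hlaw, integral_map hT.aemeasurable hm.aestronglyMeasurable] at e
    refine e.trans ?_
    have : ∀ x ∈ B, ∫ w : (Fin N → ℝ) × (Fin N → ℝ),
        F (obs12 S x w.1) * F (obs12 S x w.2) ∂(ρ.prod ρ) = g ^ 2 := by
      intro x hx
      rw [integral_prod_mul (fun z => F (obs12 S x z)) (fun z => F (obs12 S x z))]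
      have e2 : ∫ z, F (obs12 S x z) ∂ρ = x i * g := by
        rw [hg, ← integral_const_mul]
        congr 1
        ext z
        have e := obs12_mul S x 1 z
        rw [mul_one] at e
        rw [e, hFs x hx]
      rw [e2]
      linear_combination g ^ 2 * hB.sq x hx i
    rw [Finset.sum_congr rfl this, Finset.sum_const, nsmul_eq_mul, ← mul_assoc,
      inv_mul_cancel₀ hcard, one_mul]
  have hmm : mmse μ (fun ω => X ω i)
      (fun ω => fun j : {x // x ∈ S} => X ω j.1 * Z ω j.1) = 1 - g := by
    unfold mmse
    have e : ∫ ω, (X ω i - condMean μ (fun ω => X ω i)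
        (fun ω => fun j : {x // x ∈ S} => X ω j.1 * Z ω j.1) ω) ^ 2 ∂μ
        = ∫ ω, ((X ω i ^ 2 - 2 * (X ω i * F (obs12 S (X ω) (Z ω))))
          + F (obs12 S (X ω) (Z ω)) ^ 2) ∂μ := by
      refine integral_congr_ae ?_
      filter_upwards [hc1] with ω hω
      simp only [Function.comp_apply] at hω
      change (X ω i - condMean μ (fun ω => X ω i) (fun ω => obs12 S (X ω) (Z ω)) ω) ^ 2 = _
      rw [← hω]
      ring
    have i5 : Integrable (fun ω => X ω i ^ 2 - 2 * (X ω i * F (obs12 S (X ω) (Z ω)))) μ :=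
      hxi.sub (hxF.const_mul 2)
    rw [e, integral_add i5 i1, integral_sub hxi (hxF.const_mul 2),
      integral_const_mul, hx1, hq1, hs1]
    ring
  have hR : ∫ ω, (condMean μ (fun ω' => X ω' i)
            (fun ω' => fun j : {x // x ∈ S} => X ω' j.1 * Z ω' j.1) ω
          - condMean μ (fun ω' => X ω' i)
            (fun ω' => fun j : {x // x ∈ S} => X ω' j.1 * Z' ω' j.1) ω) ^ 2 ∂μ
      = 2 * g - 2 * g ^ 2 := by
    have e : ∫ ω, (condMean μ (fun ω' => X ω' i)
            (fun ω' => fun j : {x // x ∈ S} => X ω' j.1 * Z ω' j.1) ω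
          - condMean μ (fun ω' => X ω' i)
            (fun ω' => fun j : {x // x ∈ S} => X ω' j.1 * Z' ω' j.1) ω) ^ 2 ∂μ
        = ∫ ω, ((F (obs12 S (X ω) (Z ω)) ^ 2
            - 2 * (F (obs12 S (X ω) (Z ω)) * F (obs12 S (X ω) (Z' ω))))
          + F (obs12 S (X ω) (Z' ω)) ^ 2) ∂μ := by
      refine integral_congr_ae ?_
      filter_upwards [hc1, hc2] with ω hω hω2
      simp only [Function.comp_apply] at hω hω2
      change (condMean μ (fun ω => X ω i) (fun ω => obs12 S (X ω) (Z ω)) ω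
        - condMean μ (fun ω => X ω i) (fun ω => obs12 S (X ω) (Z' ω)) ω) ^ 2 = _
      rw [← hω, ← hω2]
      ring
    have i5 : Integrable (fun ω => F (obs12 S (X ω) (Z ω)) ^ 2
        - 2 * (F (obs12 S (X ω) (Z ω)) * F (obs12 S (X ω) (Z' ω)))) μ :=
      i1.sub (i3.const_mul 2)
    rw [e, integral_add i5 i2, integral_sub i1 (i3.const_mul 2),
      integral_const_mul, hcross, hs1, hs2]
    ring
  rw [hmm, hR]
  ring
end

section
/- Let C ⊆ 𝔽₂^N be a binary linear code with BPSK image C_x ⊆ {±1}^N, let X be uniformly distributed on C_x, let Z be a real random vector independent of X with independent components, let Z' be an independent copy of Z (independent of (X,Z)), and set Y = X ⊙ Z and Y' = X ⊙ Z'. Fix i ∈ {0,…,N−1} and S ⊆ {0,…,N−1}, and let (B_1,…,B_K) be a partition of S. For each k, let Y^{B_k} denote the vector obtained from Y by replacing the entries indexed by B_k with the corresponding entries of Y'. Then mmse(X_i | Y_S)·(1 − mmse(X_i | Y_S)) ≤ (1/2)·Σ_{k=1}^{K} E[ ( E[X_i | Y_S] − E[X_i | Y^{B_k}_S] )² ].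 -/
open MeasureTheory ProbabilityTheory

section Helpers

/-- coordinates in `A` are taken from the second vector. -/
def mixAt {N : ℕ} (A : Finset (Fin N)) (p : (Fin N → ℝ) × (Fin N → ℝ)) : Fin N → ℝ :=
  fun j => if j ∈ A then p.2 j else p.1 j

/-- exchange the coordinates in `A`. -/
def swapAt {N : ℕ} (A : Finset (Fin N)) (p : (Fin N → ℝ) × (Fin N → ℝ)) :
    (Fin N → ℝ) × (Fin N → ℝ) := (mixAt A p, mixAt A p.swap)

lemma measurable_mixAt {N : ℕ} (A : Finset (Fin N)) : Measurable (mixAt A) := by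
  unfold mixAt
  refine measurable_pi_lambda _ fun j => ?_
  by_cases h : j ∈ A
  · simp only [h, if_true]; fun_prop
  · simp only [h, if_false]; fun_prop

lemma measurable_swapAt {N : ℕ} (A : Finset (Fin N)) : Measurable (swapAt A) :=
  (measurable_mixAt A).prodMk ((measurable_mixAt A).comp measurable_swap)

lemma mp_swapAt {N : ℕ} (ν : Fin N → Measure ℝ) [∀ i, IsProbabilityMeasure (ν i)]
    (A : Finset (Fin N)) :
    MeasurePreserving (swapAt A) ((Measure.pi ν).prod (Measure.pi ν))
      ((Measure.pi ν).prod (Measure.pi ν)) := by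
  have e := measurePreserving_arrowProdEquivProdArrow ℝ ℝ (Fin N) ν ν
  have h2 : MeasurePreserving (fun (a : Fin N → ℝ × ℝ) j => if j ∈ A then (a j).swap else a j)
      (Measure.pi fun i => (ν i).prod (ν i)) (Measure.pi fun i => (ν i).prod (ν i)) := by
    refine measurePreserving_pi (fun i => (ν i).prod (ν i)) (fun i => (ν i).prod (ν i))
      (f := fun j (q : ℝ × ℝ) => if j ∈ A then q.swap else q) ?_
    intro j
    by_cases h : j ∈ A
    · simp only [h, if_true]; exact Measure.measurePreserving_swap
    · simp only [h, if_false]; exact MeasurePreserving.id _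
  have h3 := (e.comp h2).comp (e.symm _)
  convert h3 using 1
  funext p
  refine Prod.ext ?_ ?_ <;> funext j <;>
  by_cases h : j ∈ A <;>
  simp [swapAt, mixAt, MeasurableEquiv.arrowProdEquivProdArrow, Equiv.arrowProdEquivProdArrow, h]

lemma es_step {N : ℕ} (ν : Fin N → Measure ℝ) [∀ i, IsProbabilityMeasure (ν i)]
    (f : (Fin N → ℝ) → ℝ) (hf : Measurable f) (hb : ∀ z, |f z| ≤ 1)
    (A D : Finset (Fin N)) (hAD : Disjoint A D) :
    ∫ p, f p.1 * (f (mixAt A p) - f (mixAt (A ∪ D) p)) ∂((Measure.pi ν).prod (Measure.pi ν))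
      ≤ (1 / 2) * ∫ p, (f p.1 - f (mixAt D p)) ^ 2 ∂((Measure.pi ν).prod (Measure.pi ν)) := by
  set τ := (Measure.pi ν).prod (Measure.pi ν) with hτ
  have hd : ∀ j, j ∈ A → j ∉ D := fun j h h' => (Finset.disjoint_left.mp hAD) h h'
  have m1 : Measurable fun p : (Fin N → ℝ) × (Fin N → ℝ) => f p.1 := hf.comp measurable_fst
  have mm : ∀ A, Measurable fun p => f (mixAt A p) := fun A => hf.comp (measurable_mixAt A)
  have hbd : ∀ z, -1 ≤ f z ∧ f z ≤ 1 := fun z => abs_le.mp (hb z)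
  have eA : ∀ p, mixAt A (swapAt D p) = mixAt (A ∪ D) p := by
    intro p; funext j
    have := hd j
    by_cases h : j ∈ A <;> by_cases h' : j ∈ D <;> simp_all [mixAt, swapAt]
  have eAD : ∀ p, mixAt (A ∪ D) (swapAt D p) = mixAt A p := by
    intro p; funext j
    have := hd j
    by_cases h : j ∈ A <;> by_cases h' : j ∈ D <;> simp_all [mixAt, swapAt]
  have eD : ∀ p, mixAt D (swapAt A p) = mixAt (A ∪ D) p := by
    intro p; funext j
    have := hd j
    by_cases h : j ∈ A <;> by_cases h' : j ∈ D <;> simp_all [mixAt, swapAt]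
  have i0 : ∀ (g : (Fin N → ℝ) × (Fin N → ℝ) → ℝ), Measurable g → (∀ p, |g p| ≤ 4) →
      Integrable g τ := fun g hg hgb =>
    Integrable.of_bound hg.aestronglyMeasurable 4 (Filter.Eventually.of_forall hgb)
  have trans : ∀ (A : Finset (Fin N)) (g : (Fin N → ℝ) × (Fin N → ℝ) → ℝ), Measurable g →
      ∫ p, g (swapAt A p) ∂τ = ∫ p, g p ∂τ := by
    intro A g hg
    have h := (mp_swapAt ν A)
    conv_rhs => rw [hτ, ← h.map_eq]
    rw [integral_map h.measurable.aemeasurable hg.aestronglyMeasurable]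
  have t1 := trans D (fun p => f p.1 * (f (mixAt A p) - f (mixAt (A ∪ D) p)))
    (m1.mul ((mm _).sub (mm _)))
  simp only [eA, eAD] at t1
  have t2 := trans A (fun p => (f p.1 - f (mixAt D p)) ^ 2) ((m1.sub (mm _)).pow_const 2)
  simp only [eD] at t2
  have s1 : ∀ p, (swapAt D p).1 = mixAt D p := fun _ => rfl
  have s2 : ∀ p, (swapAt A p).1 = mixAt A p := fun _ => rfl
  simp only [s1] at t1
  simp only [s2] at t2
  have j1 : Integrable (fun p => f p.1 * (f (mixAt A p) - f (mixAt (A ∪ D) p))) τ := by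
    refine i0 _ (m1.mul ((mm _).sub (mm _))) fun p => ?_
    have := hbd p.1; have := hbd (mixAt A p); have := hbd (mixAt (A ∪ D) p)
    rw [abs_le]; constructor <;> nlinarith
  have j2 : Integrable (fun p => f (mixAt D p) * (f (mixAt (A ∪ D) p) - f (mixAt A p))) τ := by
    refine i0 _ ((mm _).mul ((mm _).sub (mm _))) fun p => ?_
    have := hbd (mixAt D p); have := hbd (mixAt A p); have := hbd (mixAt (A ∪ D) p)
    rw [abs_le]; constructor <;> nlinarith
  have j3 : Integrable (fun p => (f p.1 - f (mixAt D p)) ^ 2) τ := by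
    refine i0 _ ((m1.sub (mm _)).pow_const 2) fun p => ?_
    have := hbd p.1; have := hbd (mixAt D p)
    rw [abs_le]; constructor <;> nlinarith
  have j4 : Integrable (fun p => (f (mixAt A p) - f (mixAt (A ∪ D) p)) ^ 2) τ := by
    refine i0 _ (((mm _).sub (mm _)).pow_const 2) fun p => ?_
    have := hbd (mixAt A p); have := hbd (mixAt (A ∪ D) p)
    rw [abs_le]; constructor <;> nlinarith
  have key : ∫ p, (f p.1 * (f (mixAt A p) - f (mixAt (A ∪ D) p))
      + f (mixAt D p) * (f (mixAt (A ∪ D) p) - f (mixAt A p))) ∂τ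
      ≤ ∫ p, (1/2 * (f p.1 - f (mixAt D p)) ^ 2
        + 1/2 * (f (mixAt A p) - f (mixAt (A ∪ D) p)) ^ 2) ∂τ := by
    refine integral_mono (j1.add j2) ((j3.const_mul _).add (j4.const_mul _)) fun p => ?_
    simp only
    nlinarith [sq_nonneg ((f p.1 - f (mixAt D p)) - (f (mixAt A p) - f (mixAt (A ∪ D) p)))]
  rw [integral_add j1 j2, integral_add (j3.const_mul _) (j4.const_mul _), integral_const_mul,
    integral_const_mul, t1, t2] at key
  linarith

lemma efron_stein {N : ℕ} (ν : Fin N → Measure ℝ) [∀ i, IsProbabilityMeasure (ν i)]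
    (f : (Fin N → ℝ) → ℝ) (hf : Measurable f) (hb : ∀ z, |f z| ≤ 1)
    (S : Finset (Fin N)) (hS : ∀ z w : Fin N → ℝ, (∀ j ∈ S, z j = w j) → f z = f w)
    (K : ℕ) (B : Fin K → Finset (Fin N))
    (hdisj : ∀ k l, k ≠ l → Disjoint (B k) (B l))
    (hcover : Finset.univ.biUnion B = S) :
    ∫ z, f z ^ 2 ∂(Measure.pi ν) - (∫ z, f z ∂(Measure.pi ν)) ^ 2 ≤
    (1 / 2) * ∑ k, ∫ p, (f p.1 - f (mixAt (B k) p)) ^ 2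
      ∂((Measure.pi ν).prod (Measure.pi ν)) := by
  set τ := (Measure.pi ν).prod (Measure.pi ν) with hτ
  have m1 : Measurable fun p : (Fin N → ℝ) × (Fin N → ℝ) => f p.1 := hf.comp measurable_fst
  have m2 : Measurable fun p : (Fin N → ℝ) × (Fin N → ℝ) => f p.2 := hf.comp measurable_snd
  have mm : ∀ A, Measurable fun p => f (mixAt A p) := fun A => hf.comp (measurable_mixAt A)
  have hbd : ∀ z, -1 ≤ f z ∧ f z ≤ 1 := fun z => abs_le.mp (hb z)
  have i0 : ∀ (g : (Fin N → ℝ) × (Fin N → ℝ) → ℝ), Measurable g → (∀ p, |g p| ≤ 4) →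
      Integrable g τ := fun g hg hgb =>
    Integrable.of_bound hg.aestronglyMeasurable 4 (Filter.Eventually.of_forall hgb)
  have ind : ∀ T : Finset (Fin K), ∫ p, f p.1 * (f p.1 - f (mixAt (T.biUnion B) p)) ∂τ ≤
      (1 / 2) * ∑ k ∈ T, ∫ p, (f p.1 - f (mixAt (B k) p)) ^ 2 ∂τ := by
    classical
    intro T
    induction T using Finset.induction_on with
    | empty =>
      have e0 : ∀ p : (Fin N → ℝ) × (Fin N → ℝ), mixAt ∅ p = p.1 := by
        intro p; funext j; simp [mixAt]
      simp [e0]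
    | insert k T hk ih =>
      rw [Finset.sum_insert hk, Finset.biUnion_insert, Finset.union_comm]
      have hd : Disjoint (T.biUnion B) (B k) := by
        rw [Finset.disjoint_biUnion_left]
        intro l hl
        exact hdisj l k (by rintro rfl; exact hk hl)
      have st := es_step ν f hf hb _ _ hd
      rw [← hτ] at st
      have j1 : Integrable (fun p => f p.1 * (f p.1 - f (mixAt (T.biUnion B) p))) τ := by
        refine i0 _ (m1.mul (m1.sub (mm _))) fun p => ?_
        have := hbd p.1; have := hbd (mixAt (T.biUnion B) p)
        rw [abs_le]; constructor <;> nlinarith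
      have j2 : Integrable (fun p => f p.1 * (f (mixAt (T.biUnion B) p)
          - f (mixAt (T.biUnion B ∪ B k) p))) τ := by
        refine i0 _ (m1.mul ((mm _).sub (mm _))) fun p => ?_
        have := hbd p.1; have := hbd (mixAt (T.biUnion B) p)
        have := hbd (mixAt (T.biUnion B ∪ B k) p)
        rw [abs_le]; constructor <;> nlinarith
      have : ∫ p, f p.1 * (f p.1 - f (mixAt (T.biUnion B ∪ B k) p)) ∂τ
          = ∫ p, f p.1 * (f p.1 - f (mixAt (T.biUnion B) p)) ∂τ
          + ∫ p, f p.1 * (f (mixAt (T.biUnion B) p)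
          - f (mixAt (T.biUnion B ∪ B k) p)) ∂τ := by
        rw [← integral_add j1 j2]
        congr 1; funext p; ring
      rw [this]
      linarith
  have h := ind Finset.univ
  rw [hcover] at h
  refine le_trans (le_of_eq ?_) h
  have e1 : ∀ p, f (mixAt S p) = f p.2 := fun p => hS _ _ fun j hj => by simp [mixAt, hj]
  simp only [e1, mul_sub]
  rw [integral_sub, hτ, integral_prod_mul f f]
  · have := integral_fun_fst (μ := Measure.pi ν) (ν := Measure.pi ν) (fun z => f z * f z)
    rw [this]; simp [sq]
  · refine i0 _ (m1.mul m1) fun p => ?_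
    have := hbd p.1
    rw [abs_le]; constructor <;> nlinarith
  · refine i0 _ (m1.mul m2) fun p => ?_
    have := hbd p.1; have := hbd p.2
    rw [abs_le]; constructor <;> nlinarith

lemma condMean_transfer {Ω β : Type*} [MeasurableSpace Ω] [MeasurableSpace β]
    (μ : Measure Ω) [IsProbabilityMeasure μ] (U U' : Ω → ℝ) (W W' : Ω → β)
    (hU : Measurable U) (hU' : Measurable U') (hW : Measurable W) (hW' : Measurable W')
    (iU : Integrable U μ) (m : β → ℝ) (hm : Measurable m)
    (hmb : ∀ y, |m y| ≤ 1) (he : condMean μ U W =ᵐ[μ] fun ω => m (W ω))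
    (hl : Measure.map (fun ω => (U ω, W ω)) μ = Measure.map (fun ω => (U' ω, W' ω)) μ) :
    condMean μ U' W' =ᵐ[μ] fun ω => m (W' ω) := by
  have tr : ∀ (A : Set β) (g : ℝ × β → ℝ), MeasurableSet A → Measurable g →
      ∫ ω in W' ⁻¹' A, g (U' ω, W' ω) ∂μ = ∫ ω in W ⁻¹' A, g (U ω, W ω) ∂μ := by
    intro A g hA hg
    have hA' : MeasurableSet (Prod.snd ⁻¹' A : Set (ℝ × β)) := measurable_snd hA
    have a := setIntegral_map (μ := μ) (g := fun ω => (U ω, W ω)) hA' hg.aestronglyMeasurable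
      (hU.prodMk hW).aemeasurable
    have b := setIntegral_map (μ := μ) (g := fun ω => (U' ω, W' ω)) hA' hg.aestronglyMeasurable
      (hU'.prodMk hW').aemeasurable
    rw [← hl, a] at b
    exact b.symm
  have iU' : Integrable U' μ := by
    have a : Integrable Prod.fst (Measure.map (fun ω => (U ω, W ω)) μ) :=
      (integrable_map_measure measurable_fst.aestronglyMeasurable
        (hU.prodMk hW).aemeasurable).mpr iU
    rw [hl] at a
    exact (integrable_map_measure measurable_fst.aestronglyMeasurable
        (hU'.prodMk hW').aemeasurable).mp a
  have im : Integrable (fun ω => m (W' ω)) μ :=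
    Integrable.of_bound (hm.comp hW').aestronglyMeasurable 1
      (Filter.Eventually.of_forall fun ω => hmb _)
  symm
  unfold condMean at he ⊢
  refine ae_eq_condExp_of_forall_setIntegral_eq hW'.comap_le iU'
    (fun s _ _ => im.integrableOn) ?_ ?_
  · rintro s ⟨A, hA, rfl⟩ _
    have a := tr A (fun q => m q.2) hA (hm.comp measurable_snd)
    have b := tr A (fun q => q.1) hA measurable_fst
    simp only at a b
    rw [a, b, ← setIntegral_condExp hW.comap_le iU ⟨A, hA, rfl⟩]
    refine integral_congr_ae (ae_restrict_of_ae ?_)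
    exact he.symm
  · exact (hm.comp (comap_measurable W')).aestronglyMeasurable


lemma mem_bpskImage {N : ℕ} {C : Finset (Fin N → ZMod 2)} {x : Fin N → ℝ} :
    x ∈ bpskImage C ↔ ∃ c ∈ C, bpsk c = x :=
  @Finset.mem_image _ _ (Classical.decEq _) _ _ _

lemma bpskImage_sq {N : ℕ} {C : Finset (Fin N → ZMod 2)} {x : Fin N → ℝ}
    (hx : x ∈ bpskImage C) (j : Fin N) : x j * x j = 1 := by
  obtain ⟨c, _, rfl⟩ := mem_bpskImage.mp hx
  simp only [bpsk]
  rw [← mul_pow]; simp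

lemma bpsk_add {N : ℕ} (u v : Fin N → ZMod 2) : bpsk (u + v) = bpsk u * bpsk v := by
  funext j
  simp only [bpsk, Pi.add_apply, Pi.mul_apply]
  have h : ∀ a b : ZMod 2, (a + b).val % 2 = (a.val + b.val) % 2 := by decide
  rw [← pow_add, neg_one_pow_eq_pow_mod_two, h, ← neg_one_pow_eq_pow_mod_two]

lemma bpskImage_mul {N : ℕ} {C : Finset (Fin N → ZMod 2)}
    (hadd : ∀ u ∈ C, ∀ v ∈ C, u + v ∈ C) {x y : Fin N → ℝ}
    (hx : x ∈ bpskImage C) (hy : y ∈ bpskImage C) : x * y ∈ bpskImage C := by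
  obtain ⟨c, hc, rfl⟩ := mem_bpskImage.mp hx
  obtain ⟨d, hd, rfl⟩ := mem_bpskImage.mp hy
  exact mem_bpskImage.mpr ⟨c + d, hadd c hc d hd, bpsk_add c d⟩

lemma bpskImage_nonempty {N : ℕ} {C : Finset (Fin N → ZMod 2)}
    (h0 : (0 : Fin N → ZMod 2) ∈ C) : (bpskImage C).Nonempty := by
  exact ⟨bpsk 0, mem_bpskImage.mpr ⟨0, h0, rfl⟩⟩

lemma uniform_prob {α : Type*} [MeasurableSpace α] (s : Finset α) (hs : s.Nonempty) :
    IsProbabilityMeasure (uniformOnFinset s) := by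
  constructor
  have : (s.card : ENNReal) ≠ 0 := by simpa using hs.ne_empty
  simp [uniformOnFinset, ENNReal.inv_mul_cancel this]

lemma uniform_ae {α : Type*} [MeasurableSpace α] [MeasurableSingletonClass α] (s : Finset α) :
    ∀ᵐ x ∂(uniformOnFinset s), x ∈ s := by
  have hm : MeasurableSet ((s : Set α)ᶜ) := s.measurableSet.compl
  have : uniformOnFinset s ((s : Set α)ᶜ) = 0 := by
    simp only [uniformOnFinset, Measure.smul_apply, Measure.finsetSum_apply, smul_eq_mul]
    rw [Finset.sum_eq_zero, mul_zero]
    intro x hx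
    rw [Measure.dirac_apply' _ hm]
    simp [hx]
  exact this

lemma uniform_mp {N : ℕ} {C : Finset (Fin N → ZMod 2)}
    (hadd : ∀ u ∈ C, ∀ v ∈ C, u + v ∈ C) {h : Fin N → ℝ} (hh : h ∈ bpskImage C) :
    MeasurePreserving (fun x => h * x) (uniformOnFinset (bpskImage C))
      (uniformOnFinset (bpskImage C)) := by
  have hm : Measurable fun x : Fin N → ℝ => h * x := measurable_const_mul h
  have hhh : h * h = 1 := by funext j; exact bpskImage_sq hh j
  refine ⟨hm, ?_⟩
  unfold uniformOnFinset
  rw [Measure.map_smul, Measure.map_finset_sum hm.aemeasurable]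
  congr 1
  simp only [Measure.map_dirac' hm]
  refine Finset.sum_nbij' (fun x => h * x) (fun x => h * x) ?_ ?_ ?_ ?_ ?_
  · intro x hx; exact bpskImage_mul hadd hh hx
  · intro x hx; exact bpskImage_mul hadd hh hx
  · intro x hx; simp [← mul_assoc, hhh]
  · intro x hx; simp [← mul_assoc, hhh]
  · intro x hx; rfl

/-- bounded measurable version of the conditional mean -/
lemma condMean_version {Ω β : Type*} [MeasurableSpace Ω] [MeasurableSpace β]
    (μ : Measure Ω) [IsProbabilityMeasure μ] (U : Ω → ℝ) (W : Ω → β)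
    (hb : ∀ᵐ ω ∂μ, |U ω| ≤ 1) :
    ∃ m : β → ℝ, Measurable m ∧ (∀ y, |m y| ≤ 1) ∧ condMean μ U W =ᵐ[μ] fun ω => m (W ω) := by
  have hs : StronglyMeasurable[MeasurableSpace.comap W inferInstance] (condMean μ U W) :=
    stronglyMeasurable_condExp
  obtain ⟨m, hm, he⟩ := hs.exists_eq_measurable_comp
  have hbd : ∀ᵐ ω ∂μ, |condMean μ U W ω| ≤ 1 := by
    have := ae_bdd_condExp_of_ae_bdd (m := MeasurableSpace.comap W inferInstance)
      (R := 1) (f := U) (μ := μ) (by simpa using hb)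
    simpa [condMean] using this
  refine ⟨fun y => max (-1) (min 1 (m y)), ?_, ?_, ?_⟩
  · exact measurable_const.max (measurable_const.min hm.measurable)
  · intro y
    rw [abs_le]
    exact ⟨le_max_left _ _, max_le (by norm_num) (min_le_left _ _)⟩
  · filter_upwards [hbd] with ω hω
    have e : condMean μ U W ω = m (W ω) := congrFun he ω
    rw [e, abs_le] at hω
    rw [e, min_eq_right hω.2, max_eq_right hω.1]

lemma condMean_comp_invol {Ω β : Type*} [MeasurableSpace Ω] [MeasurableSpace β]
    (μ : Measure Ω) (U : Ω → ℝ) (W : Ω → β) (a : β → β) (ha : Measurable a)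
    (haa : ∀ y, a (a y) = y) :
    condMean μ U (fun ω => a (W ω)) = condMean μ U W := by
  unfold condMean
  congr 1
  apply le_antisymm
  · rintro s ⟨A, hA, rfl⟩
    exact ⟨a ⁻¹' A, ha hA, rfl⟩
  · rintro s ⟨A, hA, rfl⟩
    refine ⟨a ⁻¹' A, ha hA, ?_⟩
    ext ω; simp [haa]

lemma integral_mul_condMean {Ω β : Type*} [MeasurableSpace Ω] [MeasurableSpace β]
    (μ : Measure Ω) [IsProbabilityMeasure μ] (U : Ω → ℝ) (W : Ω → β) (hW : Measurable W)
    (iU : Integrable U μ) (m : β → ℝ) (hm : Measurable m) (hmb : ∀ y, |m y| ≤ 1)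
    (he : condMean μ U W =ᵐ[μ] fun ω => m (W ω)) :
    ∫ ω, U ω * m (W ω) ∂μ = ∫ ω, m (W ω) ^ 2 ∂μ := by
  have hmW : StronglyMeasurable[MeasurableSpace.comap W inferInstance] (fun ω => m (W ω)) :=
    (hm.comp (comap_measurable W)).stronglyMeasurable
  have hi : Integrable ((fun ω => m (W ω)) * U) μ :=
    iU.bdd_mul (c := 1) (hm.comp hW).aestronglyMeasurable
      (Filter.Eventually.of_forall fun ω => hmb _)
  have h := condExp_mul_of_stronglyMeasurable_left hmW hi iU
  have h2 := integral_condExp (μ := μ) hW.comap_le (f := (fun ω => m (W ω)) * U)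
  rw [integral_congr_ae h] at h2
  have e1 : ∫ ω, U ω * m (W ω) ∂μ = ∫ ω, ((fun ω => m (W ω)) * U) ω ∂μ := by
    congr 1; funext ω; simp [mul_comm]
  rw [e1, ← h2]
  refine integral_congr_ae ?_
  filter_upwards [he] with ω hω
  unfold condMean at hω
  simp only [Pi.mul_apply, hω]; ring

end Helpers

/-- Efron–Stein upper bound: for a binary linear code on a BMS channel
with a second independent use `Y' = X ⊙ Z'`, and a partition `(B_1,…,B_K)` of `S`,
`mmse(X_i|Y_S)(1 − mmse(X_i|Y_S)) ≤ ½ Σ_k E[(E[X_i|Y_S] − E[X_i|Y_S^{B_k}])²]`,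
where `Y^{B_k}` resamples the coordinates indexed by `B_k`. -/
theorem stmt_13 {Ω : Type*} [MeasurableSpace Ω] (μ : Measure Ω) [IsProbabilityMeasure μ]
    (N : ℕ) (C : Finset (Fin N → ZMod 2))
    (h0 : (0 : Fin N → ZMod 2) ∈ C)
    (hadd : ∀ u ∈ C, ∀ v ∈ C, u + v ∈ C)
    (X Z Z' : Ω → (Fin N → ℝ))
    (hX : Measurable X) (hZ : Measurable Z) (hZ' : Measurable Z')
    (ν : Fin N → Measure ℝ) (hν : ∀ i, ν i = Measure.map (fun ω => Z ω i) μ)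
    (hlaw : Measure.map (fun ω => (X ω, Z ω, Z' ω)) μ
        = (uniformOnFinset (bpskImage C)).prod ((Measure.pi ν).prod (Measure.pi ν)))
    (i : Fin N) (S : Finset (Fin N))
    (K : ℕ) (B : Fin K → Finset (Fin N))
    (hdisj : ∀ k l, k ≠ l → Disjoint (B k) (B l))
    (hcover : Finset.univ.biUnion B = S) :
    mmse μ (fun ω => X ω i)
        (fun ω => fun j : {x // x ∈ S} => X ω j.1 * Z ω j.1)
      * (1 - mmse μ (fun ω => X ω i)
          (fun ω => fun j : {x // x ∈ S} => X ω j.1 * Z ω j.1))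
    ≤ (1 / 2) * ∑ k : Fin K, ∫ ω,
        (condMean μ (fun ω' => X ω' i)
            (fun ω' => fun j : {x // x ∈ S} => X ω' j.1 * Z ω' j.1) ω
          - condMean μ (fun ω' => X ω' i)
            (fun ω' => fun j : {x // x ∈ S} =>
              if j.1 ∈ B k then X ω' j.1 * Z' ω' j.1 else X ω' j.1 * Z ω' j.1) ω) ^ 2
        ∂μ := by
  have hνp : ∀ i, IsProbabilityMeasure (ν i) := by
    intro j
    rw [hν j]
    exact Measure.isProbabilityMeasure_map ((measurable_pi_apply j).comp hZ).aemeasurable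
  set P := Measure.pi ν with hP
  set U := uniformOnFinset (bpskImage C) with hU
  haveI : IsProbabilityMeasure U := uniform_prob _ (bpskImage_nonempty h0)
  have mpΦ : MeasurePreserving (fun ω => (X ω, Z ω, Z' ω)) μ (U.prod (P.prod P)) :=
    ⟨hX.prodMk (hZ.prodMk hZ'), hlaw⟩
  have mpX : MeasurePreserving X μ U := measurePreserving_fst.comp mpΦ
  have hXG : ∀ᵐ ω ∂μ, X ω ∈ bpskImage C := mpX.quasiMeasurePreserving.ae (uniform_ae _)
  have mpZZ : MeasurePreserving (fun ω => (Z ω, Z' ω)) μ (P.prod P) :=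
    measurePreserving_snd.comp mpΦ
  have mpZ : MeasurePreserving Z μ P := measurePreserving_fst.comp mpZZ
  have mXi : Measurable fun ω => X ω i := (measurable_pi_apply i).comp hX
  have hXb : ∀ᵐ ω ∂μ, |X ω i| ≤ 1 := by
    filter_upwards [hXG] with ω hω
    have := bpskImage_sq hω i
    rw [abs_le]; constructor <;> nlinarith
  have iX : Integrable (fun ω => X ω i) μ :=
    Integrable.of_bound mXi.aestronglyMeasurable 1 hXb
  -- the channel map
  let F : (Fin N → ℝ) × (Fin N → ℝ) × (Fin N → ℝ) → ℝ × ({x // x ∈ S} → ℝ) :=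
    fun q => (q.1 i, fun j => q.1 j.1 * q.2.1 j.1)
  have hF : Measurable F := by
    refine Measurable.prodMk (by fun_prop) (measurable_pi_lambda _ fun j => ?_)
    fun_prop
  set Y : Ω → ({x // x ∈ S} → ℝ) :=
    fun ω => fun j : {x // x ∈ S} => X ω j.1 * Z ω j.1 with hY
  have mY : Measurable Y := (measurable_snd.comp hF).comp mpΦ.measurable
  obtain ⟨m, hm, hmb, he⟩ := condMean_version μ (fun ω => X ω i) Y hXb
  -- transfer of the conditional mean along measure preserving maps
  have transfer : ∀ T : (Fin N → ℝ) × (Fin N → ℝ) × (Fin N → ℝ) →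
      (Fin N → ℝ) × (Fin N → ℝ) × (Fin N → ℝ),
      MeasurePreserving T (U.prod (P.prod P)) (U.prod (P.prod P)) →
      condMean μ (fun ω => (F (T (X ω, Z ω, Z' ω))).1) (fun ω => (F (T (X ω, Z ω, Z' ω))).2)
        =ᵐ[μ] fun ω => m ((F (T (X ω, Z ω, Z' ω))).2) := by
    intro T hT
    have mTF : Measurable fun ω => F (T (X ω, Z ω, Z' ω)) :=
      hF.comp (hT.measurable.comp mpΦ.measurable)
    refine condMean_transfer μ (fun ω => X ω i) _ Y _ mXi (measurable_fst.comp mTF) mY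
      (measurable_snd.comp mTF) iX m hm hmb he ?_
    have a : Measure.map (fun ω => F (X ω, Z ω, Z' ω)) μ = Measure.map F (U.prod (P.prod P)) := by
      rw [← mpΦ.map_eq, Measure.map_map hF mpΦ.measurable]; rfl
    have b : Measure.map (fun ω => F (T (X ω, Z ω, Z' ω))) μ
        = Measure.map F (U.prod (P.prod P)) := by
      rw [← (hT.comp mpΦ).map_eq, Measure.map_map hF (hT.comp mpΦ).measurable]; rfl
    exact a.trans b.symm
  let r : (Fin N → ℝ) → ({x // x ∈ S} → ℝ) := fun z j => z j.1
  have hr : Measurable r := measurable_pi_lambda _ fun j => measurable_pi_apply _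
  -- equivariance under the code
  have equi : ∀ h ∈ bpskImage C, ∀ᵐ ω ∂μ, h i * m (Y ω) = m (r h * Y ω) := by
    intro h hh
    have t := transfer (Prod.map (fun x => h * x) id)
      ((uniform_mp hadd hh).prod (MeasurePreserving.id _))
    have e1 : (fun ω => (F (Prod.map (fun x => h * x) id (X ω, Z ω, Z' ω))).2)
        = fun ω => r h * Y ω := by
      funext ω; funext j; simp [F, r, hY, mul_assoc]
    have e2 : (fun ω => (F (Prod.map (fun x => h * x) id (X ω, Z ω, Z' ω))).1)
        = h i • fun ω => X ω i := by
      funext ω; simp [F]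
    have e3 : (fun ω => m ((F (Prod.map (fun x => h * x) id (X ω, Z ω, Z' ω))).2))
        = fun ω => m (r h * Y ω) := by
      funext ω; exact congrArg m (congrFun e1 ω)
    rw [e1, e2, e3, condMean_comp_invol μ _ Y (fun y => r h * y) (measurable_const_mul _)] at t
    · have sm : condMean μ (h i • fun ω => X ω i) Y =ᵐ[μ] h i • condMean μ (fun ω => X ω i) Y :=
        condExp_smul _ _ _
      filter_upwards [t, sm, he] with ω h1 h2 h3
      rw [← h1, h2, Pi.smul_apply, h3, smul_eq_mul]
    · intro y; funext j
      simp only [Pi.mul_apply, r]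
      rw [← mul_assoc, bpskImage_sq hh, one_mul]
  have equi2 : ∀ᵐ ω ∂μ, X ω i * m (Y ω) = m (r (Z ω)) := by
    have := (Finset.eventually_all (bpskImage C) (l := ae μ)
      (p := fun h ω => h i * m (Y ω) = m (r h * Y ω))).mpr equi
    filter_upwards [this, hXG] with ω h1 h2
    rw [h1 _ h2]
    congr 1
    funext j
    simp only [Pi.mul_apply, r, hY]
    rw [← mul_assoc, bpskImage_sq h2, one_mul]
  -- the same statement on the law
  have mq : MeasurableSet {q : (Fin N → ℝ) × (Fin N → ℝ) × (Fin N → ℝ) |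
      q.1 i * m ((F q).2) = m (r q.2.1)} := by
    refine measurableSet_eq_fun ?_ ?_
    · exact ((measurable_pi_apply i).comp measurable_fst).mul
        (hm.comp (measurable_snd.comp hF))
    · exact hm.comp (hr.comp (measurable_fst.comp measurable_snd))
  have lawequi : ∀ᵐ q ∂(U.prod (P.prod P)), q.1 i * m ((F q).2) = m (r q.2.1) := by
    rw [← mpΦ.map_eq, ae_map_iff mpΦ.measurable.aemeasurable mq]
    exact equi2
  -- the noise function
  let f : (Fin N → ℝ) → ℝ := fun z => m (r z)
  have hf : Measurable f := hm.comp hr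
  have es := efron_stein ν f hf (fun z => hmb _) S
    (fun z w h => congrArg m (funext fun j => h j.1 j.2)) K B hdisj hcover
  rw [← hP] at es
  have terms : ∀ k, ∫ ω,
        (condMean μ (fun ω' => X ω' i) Y ω
          - condMean μ (fun ω' => X ω' i)
            (fun ω' => fun j : {x // x ∈ S} =>
              if j.1 ∈ B k then X ω' j.1 * Z' ω' j.1 else X ω' j.1 * Z ω' j.1) ω) ^ 2
        ∂μ = ∫ p, (f p.1 - f (mixAt (B k) p)) ^ 2 ∂(P.prod P) := by
    intro k
    have mpT : MeasurePreserving (Prod.map id (swapAt (B k))) (U.prod (P.prod P))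
        (U.prod (P.prod P)) := (MeasurePreserving.id _).prod (mp_swapAt ν (B k))
    have t := transfer _ mpT
    have e1 : (fun ω => (F (Prod.map id (swapAt (B k)) (X ω, Z ω, Z' ω))).2)
        = (fun ω' => fun j : {x // x ∈ S} =>
              if j.1 ∈ B k then X ω' j.1 * Z' ω' j.1 else X ω' j.1 * Z ω' j.1) := by
      funext ω; funext j
      by_cases h : j.1 ∈ B k <;> simp [F, swapAt, mixAt, h]
    rw [e1] at t
    have t2 : ∀ᵐ ω ∂μ, X ω i * m ((F (Prod.map id (swapAt (B k)) (X ω, Z ω, Z' ω))).2)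
        = f (mixAt (B k) (Z ω, Z' ω)) :=
      (mpT.comp mpΦ).quasiMeasurePreserving.ae lawequi
    have mg : Measurable fun p : (Fin N → ℝ) × (Fin N → ℝ) =>
        (f p.1 - f (mixAt (B k) p)) ^ 2 :=
      ((hf.comp measurable_fst).sub (hf.comp (measurable_mixAt _))).pow_const 2
    rw [← mpZZ.map_eq, integral_map mpZZ.measurable.aemeasurable mg.aestronglyMeasurable]
    refine integral_congr_ae ?_
    filter_upwards [t, t2, he, equi2, hXG] with ω h1 h2 h3 h4 h5
    have sq1 := bpskImage_sq h5 i
    have h1' : condMean μ (fun ω' => X ω' i)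
            (fun ω' => fun j : {x // x ∈ S} =>
              if j.1 ∈ B k then X ω' j.1 * Z' ω' j.1 else X ω' j.1 * Z ω' j.1) ω
          = m ((F (Prod.map id (swapAt (B k)) (X ω, Z ω, Z' ω))).2) := h1
    rw [h1', h3, ← h2]
    change _ = (m (r (Z ω)) - _) ^ 2
    rw [← h4, ← mul_sub, mul_pow, sq (X ω i), sq1, one_mul]
  simp only [terms]
  -- the minimum mean squared error
  have q1 : ∫ ω, X ω i * m (Y ω) ∂μ = ∫ z, f z ∂P := by
    rw [← mpZ.map_eq, integral_map mpZ.measurable.aemeasurable hf.aestronglyMeasurable]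
    exact integral_congr_ae equi2
  have q2 : ∫ ω, m (Y ω) ^ 2 ∂μ = ∫ z, f z ^ 2 ∂P := by
    rw [← mpZ.map_eq, integral_map mpZ.measurable.aemeasurable
      (hf.pow_const 2).aestronglyMeasurable]
    refine integral_congr_ae ?_
    filter_upwards [equi2, hXG] with ω h4 h5
    have sq1 := bpskImage_sq h5 i
    change _ = m (r (Z ω)) ^ 2
    rw [← h4, mul_pow, sq (X ω i), sq1, one_mul]
  have q3 := integral_mul_condMean μ _ Y mY iX m hm hmb he
  have mmse_eq : mmse μ (fun ω => X ω i) Y = 1 - ∫ z, f z ∂P := by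
    have j1 : Integrable (fun ω => X ω i * m (Y ω)) μ := by
      refine Integrable.of_bound (mXi.mul (hm.comp mY)).aestronglyMeasurable 1 ?_
      filter_upwards [hXb] with ω hω
      rw [Real.norm_eq_abs, abs_mul]
      exact mul_le_one₀ hω (abs_nonneg _) (hmb _)
    have j2 : Integrable (fun ω => m (Y ω) ^ 2) μ := by
      refine Integrable.of_bound ((hm.comp mY).pow_const 2).aestronglyMeasurable 1 ?_
      refine Filter.Eventually.of_forall fun ω => ?_
      rw [Real.norm_eq_abs, abs_pow]
      exact pow_le_one₀ (abs_nonneg _) (hmb _)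
    have e : mmse μ (fun ω => X ω i) Y
        = ∫ ω, (1 - 2 * (X ω i * m (Y ω)) + m (Y ω) ^ 2) ∂μ := by
      unfold mmse
      refine integral_congr_ae ?_
      filter_upwards [he, hXG] with ω h3 h5
      have sq1 := bpskImage_sq h5 i
      rw [h3]
      linear_combination sq1
    have j0 : Integrable (fun ω => 1 - 2 * (X ω i * m (Y ω))) μ :=
      (integrable_const _).sub (j1.const_mul _)
    rw [e, integral_add j0 j2,
      integral_sub (integrable_const _) (j1.const_mul _), integral_const_mul, ← q3, q1]
    simp
    ring
  rw [mmse_eq]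
  rw [← q2, ← q3, q1] at es
  refine le_trans (le_of_eq ?_) es
  ring
end

section
/- Let X be a {−1,+1}-valued random variable with mean μ ∈ [−1,1], let Z be a real-valued random variable, and let U be a random variable such that Z is independent of the pair (X, U); set Y := X·Z. Let X_u be uniform on {±1}, independent of Z' with the same law as Z, set Y_u := X_u·Z', q_k := E[(E[X_u|Y_u])^{2k}], c_k := 1/(ln(2)·2k·(2k−1)), and let C := Σ_{k=1}^{∞} c_k·q_k be the capacity of the channel from X to Y. Then BER(X | Y, U) ≥ BER(X | Y) − √( ln(2)·(1 − C)·(1 − mmse(X | U)) / 2 ). -/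
open MeasureTheory ProbabilityTheory

lemma aux_int {Ω : Type*} [MeasurableSpace Ω] (μ : Measure Ω) [IsFiniteMeasure μ]
    (f : Ω → ℝ) (hf : AEStronglyMeasurable f μ) (h : ∀ᵐ ω ∂μ, |f ω| ≤ 1) : Integrable f μ :=
  Integrable.of_bound hf 1 (by simpa [Real.norm_eq_abs] using h)

lemma aux_mul {Ω β : Type*} [MeasurableSpace Ω] [MeasurableSpace β]
    (μ : Measure Ω) [IsProbabilityMeasure μ] (X : Ω → ℝ) (W : Ω → β)
    (hX : Measurable X) (hW : Measurable W) (hb : ∀ᵐ ω ∂μ, |X ω| ≤ 1)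
    (F : Ω → ℝ) (hF : StronglyMeasurable[MeasurableSpace.comap W inferInstance] F)
    (hFb : ∀ᵐ ω ∂μ, |F ω| ≤ 1) :
    ∫ ω, X ω * F ω ∂μ = ∫ ω, condMean μ X W ω * F ω ∂μ := by
  have hm : MeasurableSpace.comap W inferInstance ≤ (inferInstance : MeasurableSpace Ω) :=
    hW.comap_le
  have hXi : Integrable X μ := aux_int μ X hX.aestronglyMeasurable hb
  have hFm := (hF.mono hm).aestronglyMeasurable (μ := μ)
  have hXF : Integrable (X * F) μ := by
    apply aux_int μ _ (hX.aestronglyMeasurable.mul hFm)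
    filter_upwards [hFb, hb] with ω h h'
    simp only [Pi.mul_apply, abs_mul]
    exact mul_le_one₀ h' (abs_nonneg _) h
  have h1 := condExp_mul_of_stronglyMeasurable_right hF hXF hXi
  have h2 := integral_condExp (μ := μ) (f := X * F) hm
  calc ∫ ω, X ω * F ω ∂μ = ∫ ω, (X * F) ω ∂μ := rfl
    _ = _ := h2.symm
    _ = _ := integral_congr_ae h1

lemma aux_bdd {Ω β : Type*} [MeasurableSpace Ω] [MeasurableSpace β]
    (μ : Measure Ω) [IsProbabilityMeasure μ] (X : Ω → ℝ) (W : Ω → β)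
    (hb : ∀ᵐ ω ∂μ, |X ω| ≤ 1) :
    ∀ᵐ ω ∂μ, |condMean μ X W ω| ≤ 1 := by
  exact ae_bdd_abs_condExp_of_ae_bdd_abs (R := (1 : ℝ)) hb

lemma aux_sm {Ω β : Type*} [MeasurableSpace Ω] [MeasurableSpace β]
    (μ : Measure Ω) (X : Ω → ℝ) (W : Ω → β) :
    StronglyMeasurable[MeasurableSpace.comap W inferInstance] (condMean μ X W) :=
  stronglyMeasurable_condExp

lemma aux_sm' {Ω β : Type*} [MeasurableSpace Ω] [MeasurableSpace β]
    (μ : Measure Ω) (X : Ω → ℝ) (W : Ω → β) (hW : Measurable W) :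
    AEStronglyMeasurable (condMean μ X W) μ :=
  ((aux_sm μ X W).mono hW.comap_le).aestronglyMeasurable

lemma aux_le {Ω β : Type*} [MeasurableSpace Ω] [MeasurableSpace β]
    (μ : Measure Ω) [IsProbabilityMeasure μ] (X : Ω → ℝ) (W : Ω → β)
    (hX : Measurable X) (hW : Measurable W) (hb : ∀ᵐ ω ∂μ, |X ω| ≤ 1)
    (F : β → ℝ) (hF : Measurable F) (hFb : ∀ y, |F y| ≤ 1) :
    ∫ ω, X ω * F (W ω) ∂μ ≤ ∫ ω, |condMean μ X W ω| ∂μ := by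
  have hFW : StronglyMeasurable[MeasurableSpace.comap W inferInstance] (fun ω => F (W ω)) :=
    (hF.comp (comap_measurable W)).stronglyMeasurable
  rw [aux_mul μ X W hX hW hb (fun ω => F (W ω)) hFW (ae_of_all _ fun ω => hFb _)]
  have hc := aux_bdd μ X W hb
  have hcm := aux_sm' μ X W hW
  have key : ∀ ω, |condMean μ X W ω * F (W ω)| ≤ |condMean μ X W ω| := fun ω => by
    rw [abs_mul]; exact mul_le_of_le_one_right (abs_nonneg _) (hFb _)
  refine integral_mono (aux_int μ _ (hcm.mul (hF.comp hW).aestronglyMeasurable) ?_)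
    (aux_int μ _ hcm.norm ?_) (fun ω => (le_abs_self _).trans (key ω))
  · filter_upwards [hc] with ω h using (key ω).trans h
  · filter_upwards [hc] with ω h
    simpa using h

lemma aux_ex {Ω β : Type*} [MeasurableSpace Ω] [MeasurableSpace β]
    (μ : Measure Ω) [IsProbabilityMeasure μ] (X : Ω → ℝ) (W : Ω → β)
    (hX : Measurable X) (hW : Measurable W) (hb : ∀ᵐ ω ∂μ, |X ω| ≤ 1) :
    ∃ F : β → ℝ, Measurable F ∧ (∀ y, |F y| ≤ 1) ∧
      ∫ ω, |condMean μ X W ω| ∂μ = ∫ ω, X ω * F (W ω) ∂μ := by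
  classical
  have hs : MeasurableSet[MeasurableSpace.comap W inferInstance] {ω | 0 ≤ condMean μ X W ω} :=
    (aux_sm μ X W).measurable measurableSet_Ici
  obtain ⟨S, hS, hSe⟩ := hs
  have hF : Measurable (fun y => if y ∈ S then (1 : ℝ) else -1) :=
    Measurable.ite hS measurable_const measurable_const
  have hFb : ∀ y, |(if y ∈ S then (1 : ℝ) else -1)| ≤ 1 := fun y => by split_ifs <;> simp
  refine ⟨_, hF, hFb, ?_⟩
  have hFW : StronglyMeasurable[MeasurableSpace.comap W inferInstance]
      (fun ω => if W ω ∈ S then (1 : ℝ) else -1) :=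
    (hF.comp (comap_measurable W)).stronglyMeasurable
  rw [aux_mul μ X W hX hW hb _ hFW (ae_of_all _ fun ω => hFb _)]
  congr 1
  ext ω
  have : W ω ∈ S ↔ 0 ≤ condMean μ X W ω := by
    change ω ∈ W ⁻¹' S ↔ _
    rw [hSe]; rfl
  by_cases h : 0 ≤ condMean μ X W ω
  · rw [if_pos (this.2 h), abs_of_nonneg h, mul_one]
  · rw [if_neg (fun h' => h (this.1 h')), abs_of_neg (not_le.1 h)]; ring

lemma aux_mmse {Ω β : Type*} [MeasurableSpace Ω] [MeasurableSpace β]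
    (μ : Measure Ω) [IsProbabilityMeasure μ] (X : Ω → ℝ) (W : Ω → β)
    (hX : Measurable X) (hW : Measurable W) (hpm : ∀ ω, X ω = -1 ∨ X ω = 1) :
    1 - mmse μ X W = ∫ ω, condMean μ X W ω ^ 2 ∂μ := by
  have hb : ∀ ω, |X ω| ≤ 1 := fun ω => by rcases hpm ω with h | h <;> simp [h]
  have hc := aux_bdd μ X W (ae_of_all _ hb)
  have hcm := aux_sm' μ X W hW
  have h1 := aux_mul μ X W hX hW (ae_of_all _ hb) _ (aux_sm μ X W) hc
  have e : ∀ ω, (X ω - condMean μ X W ω) ^ 2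
      = 1 - 2 * (X ω * condMean μ X W ω) + condMean μ X W ω * condMean μ X W ω := fun ω => by
    have : X ω ^ 2 = 1 := by rcases hpm ω with h | h <;> simp [h]
    linear_combination this
  have i1 : Integrable (fun ω => X ω * condMean μ X W ω) μ := by
    apply aux_int μ (fun ω => X ω * condMean μ X W ω) (hX.aestronglyMeasurable.mul hcm)
    filter_upwards [hc] with ω h
    rw [abs_mul]
    exact mul_le_one₀ (hb ω) (abs_nonneg _) h
  have i2 : Integrable (fun ω => condMean μ X W ω * condMean μ X W ω) μ := by
    apply aux_int μ (fun ω => condMean μ X W ω * condMean μ X W ω) (hcm.mul hcm)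
    filter_upwards [hc] with ω h
    rw [abs_mul]
    exact mul_le_one₀ h (abs_nonneg _) h
  unfold mmse
  simp_rw [e]
  have i3 : Integrable (fun ω => 1 - 2 * (X ω * condMean μ X W ω)) μ :=
    (integrable_const _).sub (i1.const_mul 2)
  rw [integral_add i3 i2, integral_sub (integrable_const _) (i1.const_mul 2), integral_const_mul, h1]
  simp [pow_two]
  ring

lemma aux_sq {Ω : Type*} [MeasurableSpace Ω]
    (μ : Measure Ω) [IsProbabilityMeasure μ] (m : Ω → ℝ) (hm : AEStronglyMeasurable m μ)
    (hc : ∀ᵐ ω ∂μ, |m ω| ≤ 1) : (∫ ω, |m ω| ∂μ) ^ 2 ≤ ∫ ω, m ω ^ 2 ∂μ := by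
  have i1 : Integrable (fun ω => |m ω|) μ := aux_int μ _ hm.norm (by simpa using hc)
  have i2 : Integrable (fun ω => m ω ^ 2) μ := by
    apply aux_int μ (fun ω => m ω ^ 2) (hm.pow 2)
    filter_upwards [hc] with ω h
    rw [abs_pow]
    exact pow_le_one₀ (abs_nonneg _) h
  set a := ∫ ω, |m ω| ∂μ with ha
  have h0 : 0 ≤ ∫ ω, (|m ω| - a) ^ 2 ∂μ := integral_nonneg fun ω => sq_nonneg _
  have e : ∀ ω, (|m ω| - a) ^ 2 = m ω ^ 2 - 2 * a * |m ω| + a ^ 2 := fun ω => by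
    rw [← sq_abs (m ω)]; ring
  simp_rw [e] at h0
  have i3 : Integrable (fun ω => m ω ^ 2 - 2 * a * |m ω|) μ := i2.sub (i1.const_mul _)
  rw [integral_add i3 (integrable_const _),
    integral_sub i2 (i1.const_mul _), integral_const_mul, ← ha] at h0
  simp at h0
  nlinarith

lemma aux_log (n : ℕ) (hn : 0 < n) (m : ℕ) :
    ∑ j ∈ Finset.range m, 1 / ((n : ℝ) + j + 1) ≤ Real.log (n + m) - Real.log n := by
  induction m with
  | zero => simp
  | succ k ih =>
    rw [Finset.sum_range_succ]
    have hp : (0 : ℝ) < n + k := by positivity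
    have h := Real.one_sub_inv_le_log_of_pos (x := ((n : ℝ) + k + 1) / (n + k)) (by positivity)
    rw [Real.log_div (by positivity) (by positivity)] at h
    have e : 1 - (((n : ℝ) + k + 1) / (n + k))⁻¹ = 1 / (n + k + 1) := by
      field_simp; ring
    rw [e] at h
    push_cast
    rw [← add_assoc]
    linarith

lemma aux_harm (n : ℕ) :
    ∑ i ∈ Finset.range n, 1 / ((2 * (i : ℝ) + 2) * (2 * i + 1))
      = ∑ j ∈ Finset.range n, 1 / ((n : ℝ) + j + 1) := by
  induction n with
  | zero => simp
  | succ n ih =>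
    rw [Finset.sum_range_succ, ih]
    have h := Finset.sum_range_succ' (fun j : ℕ => 1 / ((n : ℝ) + j + 1)) n
    rw [Finset.sum_range_succ] at h
    rw [Finset.sum_range_succ]
    have e : ∀ j : ℕ, (n : ℝ) + (j + 1 : ℕ) + 1 = (n + 1 : ℕ) + j + 1 := fun j => by
      push_cast; ring
    simp only [e] at h
    have h2 : ∑ j ∈ Finset.range n, 1 / ((n : ℝ) + j + 1)
      = ∑ j ∈ Finset.range n, 1 / (((n + 1 : ℕ) : ℝ) + j + 1) + 1 / ((n : ℝ) + (0 : ℕ) + 1)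
        - 1 / ((n : ℝ) + n + 1) := by linarith
    rw [h2]
    push_cast
    have : (0 : ℝ) ≤ n := Nat.cast_nonneg n
    have a1 : (n : ℝ) + n + 1 ≠ 0 := by positivity
    have a2 : (n : ℝ) + 1 + n + 1 ≠ 0 := by positivity
    have a3 : 2 * (n : ℝ) + 2 ≠ 0 := by positivity
    have a4 : 2 * (n : ℝ) + 1 ≠ 0 := by positivity
    have a5 : (n : ℝ) + 0 + 1 ≠ 0 := by positivity
    field_simp
    ring

lemma aux_ck (n : ℕ) : ∑ i ∈ Finset.range n, ck (i + 1) ≤ 1 := by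
  have hl : 0 < Real.log 2 := Real.log_pos (by norm_num)
  have e : ∀ i : ℕ, ck (i + 1) = 1 / ((2 * (i : ℝ) + 2) * (2 * i + 1)) / Real.log 2 := fun i => by
    unfold ck
    push_cast
    rw [div_div]
    congr 1
    ring
  simp_rw [e]
  rw [← Finset.sum_div, div_le_one hl, aux_harm]
  rcases Nat.eq_zero_or_pos n with rfl | hn
  · simpa using hl.le
  · refine (aux_log n hn n).trans ?_
    have hp : (0 : ℝ) < n := by exact_mod_cast hn
    rw [← two_mul, Real.log_mul (by norm_num) hp.ne']
    linarith

lemma aux_tsum (q : ℕ → ℝ) (h0 : ∀ k, 0 ≤ q k) (h1 : ∀ k, q k ≤ 1) :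
    Real.log 2 * (1 - ∑' k : ℕ, ck (k + 1) * q (k + 1)) ≥ (1 - q 1) / 2 := by
  have hl : 0 < Real.log 2 := Real.log_pos (by norm_num)
  have hc : ∀ i : ℕ, 0 ≤ ck (i + 1) := fun i => by
    unfold ck
    push_cast
    have : (0 : ℝ) ≤ 2 * (i + 1) - 1 := by linarith [Nat.cast_nonneg (α := ℝ) i]
    positivity
  have h : ∑' k : ℕ, ck (k + 1) * q (k + 1) ≤ 1 - ck 1 * (1 - q 1) := by
    refine Real.tsum_le_of_sum_range_le (fun i => mul_nonneg (hc i) (h0 _)) fun n => ?_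
    have s1 : ∑ i ∈ Finset.range n, ck (i + 1) * q (i + 1)
        ≤ ∑ i ∈ Finset.range (n + 1), ck (i + 1) * q (i + 1) := by
      rw [Finset.sum_range_succ]
      linarith [mul_nonneg (hc n) (h0 (n + 1))]
    have s2 := aux_ck (n + 1)
    rw [Finset.sum_range_succ'] at s1 s2
    have s3 : ∑ i ∈ Finset.range n, ck (i + 1 + 1) * q (i + 1 + 1)
        ≤ ∑ i ∈ Finset.range n, ck (i + 1 + 1) :=
      Finset.sum_le_sum fun i _ => mul_le_of_le_one_right (hc _) (h1 _)
    simp only [zero_add] at s1 s2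
    linarith
  have hc1 : Real.log 2 * ck 1 = 1 / 2 := by
    unfold ck; norm_num; field_simp
  have := mul_le_mul_of_nonneg_left h hl.le
  have e : Real.log 2 * (1 - ck 1 * (1 - q 1)) = Real.log 2 - 1 / 2 * (1 - q 1) := by
    rw [← hc1]; ring
  rw [e] at this
  linarith

instance aux_prob : IsProbabilityMeasure signMeasure := by
  constructor
  simp only [signMeasure, Measure.smul_apply, Measure.add_apply, measure_univ, smul_eq_mul]
  rw [one_add_one_eq_two]
  exact ENNReal.inv_mul_cancel (by norm_num) (by norm_num)

lemma aux_sign (f : ℝ → ℝ) : ∫ x, f x ∂signMeasure = (f (-1) + f 1) / 2 := by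
  unfold signMeasure
  rw [integral_smul_measure, integral_add_measure (integrable_dirac (by simp))
    (integrable_dirac (by simp)), integral_dirac, integral_dirac]
  simp
  ring

lemma aux_ae : ∀ᵐ x ∂signMeasure, |x| ≤ 1 := by
  unfold signMeasure
  apply Measure.ae_smul_measure
  rw [ae_add_measure_iff]
  simp [ae_dirac_eq]

lemma aux_ae2 (P : Measure ℝ) [IsProbabilityMeasure P] :
    ∀ᵐ p ∂(signMeasure.prod P), |p.1| ≤ 1 :=
  Measure.quasiMeasurePreserving_fst.ae aux_ae

lemma aux_prod (P : Measure ℝ) [IsProbabilityMeasure P] (g : ℝ → ℝ) (hg : Measurable g)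
    (hb : ∀ y, |g y| ≤ 1) :
    ∫ p : ℝ × ℝ, p.1 * g (p.1 * p.2) ∂(signMeasure.prod P)
      = (∫ z, g z ∂P - ∫ z, g (-z) ∂P) / 2 := by
  have i : Integrable (fun p : ℝ × ℝ => p.1 * g (p.1 * p.2)) (signMeasure.prod P) := by
    apply aux_int
    · exact Measurable.aestronglyMeasurable (by fun_prop)
    · filter_upwards [aux_ae2 P] with p hp
      rw [abs_mul]
      exact mul_le_one₀ hp (abs_nonneg _) (hb _)
  rw [integral_prod _ i, aux_sign]
  simp only [neg_mul, one_mul, integral_neg]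
  ring

/-- average absolute conditional mean of the symmetric channel -/
noncomputable def auxT (P : Measure ℝ) : ℝ :=
  ∫ p, |condMean (signMeasure.prod P) (fun q : ℝ × ℝ => q.1) (fun q : ℝ × ℝ => q.1 * q.2) p|
    ∂(signMeasure.prod P)

lemma auxT_le (P : Measure ℝ) [IsProbabilityMeasure P] (g : ℝ → ℝ) (hg : Measurable g)
    (hb : ∀ y, |g y| ≤ 1) : (∫ z, g z ∂P - ∫ z, g (-z) ∂P) / 2 ≤ auxT P := by
  rw [← aux_prod P g hg hb]
  exact aux_le _ _ _ measurable_fst (by fun_prop) (aux_ae2 P) g hg hb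

lemma auxT_ex (P : Measure ℝ) [IsProbabilityMeasure P] : ∃ g : ℝ → ℝ, Measurable g ∧
    (∀ y, |g y| ≤ 1) ∧ (∫ z, g z ∂P - ∫ z, g (-z) ∂P) / 2 = auxT P := by
  obtain ⟨g, hg, hb, h⟩ := aux_ex (signMeasure.prod P) (fun q : ℝ × ℝ => q.1)
    (fun q : ℝ × ℝ => q.1 * q.2) measurable_fst (by fun_prop) (aux_ae2 P)
  exact ⟨g, hg, hb, by rw [← aux_prod P g hg hb, ← h]; rfl⟩

lemma aux_q (P : Measure ℝ) [IsProbabilityMeasure P] :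
    (∀ k, 0 ≤ qmom P k) ∧ (∀ k, qmom P k ≤ 1) ∧ qmom P 1 ≤ auxT P ∧ 0 ≤ auxT P ∧ auxT P ≤ 1 := by
  have hc := aux_bdd (signMeasure.prod P) (fun q : ℝ × ℝ => q.1)
    (fun q : ℝ × ℝ => q.1 * q.2) (aux_ae2 P)
  have hm := aux_sm' (signMeasure.prod P) (fun q : ℝ × ℝ => q.1)
    (fun q : ℝ × ℝ => q.1 * q.2) (by fun_prop)
  unfold qmom auxT
  generalize condMean (signMeasure.prod P) (fun q : ℝ × ℝ => q.1)
    (fun q : ℝ × ℝ => q.1 * q.2) = t at hc hm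
  have i1 : Integrable (fun p => |t p|) (signMeasure.prod P) :=
    aux_int _ _ hm.norm (by simpa using hc)
  have ik : ∀ k, Integrable (fun p => t p ^ k) (signMeasure.prod P) := fun k => by
    apply aux_int _ (fun p => t p ^ k) (hm.pow k)
    filter_upwards [hc] with ω h
    rw [abs_pow]
    exact pow_le_one₀ (abs_nonneg _) h
  refine ⟨fun k => integral_nonneg fun p => ?_, fun k => ?_, ?_,
    integral_nonneg fun p => abs_nonneg _, ?_⟩
  · exact (even_two_mul k).pow_nonneg _
  · have : ∫ p, t p ^ (2 * k) ∂(signMeasure.prod P) ≤ ∫ p, 1 ∂(signMeasure.prod P) := by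
      apply integral_mono_ae (ik _) (integrable_const _)
      filter_upwards [hc] with p h
      rw [← (even_two_mul k).pow_abs]
      exact pow_le_one₀ (abs_nonneg _) h
    simpa using this
  · apply integral_mono_ae (ik _) i1
    filter_upwards [hc] with p h
    rw [mul_one, ← sq_abs]
    nlinarith [abs_nonneg (t p)]
  · have : ∫ p, |t p| ∂(signMeasure.prod P) ≤ ∫ p, 1 ∂(signMeasure.prod P) :=
      integral_mono_ae i1 (integrable_const _) hc
    simpa using this

lemma aux_lower {Ω : Type*} [MeasurableSpace Ω]
    (μ : Measure Ω) [IsProbabilityMeasure μ]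
    (X Z : Ω → ℝ) (hX : Measurable X) (hZ : Measurable Z)
    (hpm : ∀ ω, X ω = -1 ∨ X ω = 1) :
    auxT (Measure.map Z μ) ≤ ∫ ω, |condMean μ X (fun ω => X ω * Z ω) ω| ∂μ := by
  have hP : IsProbabilityMeasure (Measure.map Z μ) :=
    Measure.isProbabilityMeasure_map hZ.aemeasurable
  have hb : ∀ ω, |X ω| ≤ 1 := fun ω => by rcases hpm ω with h | h <;> simp [h]
  obtain ⟨g, hg, hgb, h⟩ := auxT_ex (Measure.map Z μ)
  have i1 : Integrable g (Measure.map Z μ) :=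
    aux_int _ _ hg.aestronglyMeasurable (ae_of_all _ hgb)
  have i2 : Integrable (fun z => g (-z)) (Measure.map Z μ) :=
    aux_int _ _ (hg.comp measurable_neg).aestronglyMeasurable (ae_of_all _ fun z => hgb _)
  have hg' : Measurable (fun y => (g y - g (-y)) / 2) := by fun_prop
  have hgb' : ∀ y, |(g y - g (-y)) / 2| ≤ 1 := fun y => by
    have := abs_le.1 (hgb y)
    have := abs_le.1 (hgb (-y))
    rw [abs_le]; constructor <;> linarith
  have h2 := aux_le μ X (fun ω => X ω * Z ω) hX (by fun_prop) (ae_of_all _ hb) _ hg' hgb'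
  refine le_trans (le_of_eq ?_) h2
  rw [← h, ← integral_sub i1 i2, ← integral_div, integral_map hZ.aemeasurable
    hg'.aestronglyMeasurable]
  congr 1
  ext ω
  rcases hpm ω with h | h <;> simp [h]
  ring

lemma aux_upper {Ω β : Type*} [MeasurableSpace Ω] [MeasurableSpace β]
    (μ : Measure Ω) [IsProbabilityMeasure μ]
    (X Z : Ω → ℝ) (U : Ω → β)
    (hX : Measurable X) (hZ : Measurable Z) (hU : Measurable U)
    (hpm : ∀ ω, X ω = -1 ∨ X ω = 1)
    (hindep : IndepFun (fun ω => (X ω, U ω)) Z μ) :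
    ∫ ω, |condMean μ X (fun ω => (X ω * Z ω, U ω)) ω| ∂μ ≤ auxT (Measure.map Z μ)
      + (∫ ω, |condMean μ X U ω| ∂μ) * (1 - auxT (Measure.map Z μ)) := by
  have hP : IsProbabilityMeasure (Measure.map Z μ) :=
    Measure.isProbabilityMeasure_map hZ.aemeasurable
  have hb : ∀ ω, |X ω| ≤ 1 := fun ω => by rcases hpm ω with h | h <;> simp [h]
  obtain ⟨F, hF, hFb, h⟩ := aux_ex μ X (fun ω => (X ω * Z ω, U ω)) hX (by fun_prop)
    (ae_of_all _ hb)
  rw [h]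
  have hXU : Measurable (fun ω => (X ω, U ω)) := by fun_prop
  have hmap := (indepFun_iff_map_prod_eq_prod_map_map hXU.aemeasurable hZ.aemeasurable).1 hindep
  have hPU : IsProbabilityMeasure (Measure.map (fun ω => (X ω, U ω)) μ) :=
    Measure.isProbabilityMeasure_map hXU.aemeasurable
  set P := Measure.map Z μ with hPdef
  set G : ℝ → β → ℝ := fun x u => ∫ z, F (x * z, u) ∂P with hG
  have hK : Measurable (fun p : (ℝ × β) × ℝ => F (p.1.1 * p.2, p.1.2)) := by fun_prop
  have hGm : Measurable (fun p : ℝ × β => G p.1 p.2) :=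
    (hK.stronglyMeasurable.integral_prod_right (ν := P)).measurable
  have hGb : ∀ x u, |G x u| ≤ 1 := fun x u => by
    have := norm_integral_le_of_norm_le_const (μ := P) (f := fun z => F (x * z, u)) (C := 1)
      (ae_of_all _ fun z => by simpa using hFb _)
    simpa using this
  have hKm : Measurable (fun p : (ℝ × β) × ℝ => p.1.1 * F (p.1.1 * p.2, p.1.2)) := by fun_prop
  -- Fubini
  have e1 : ∫ ω, X ω * F (X ω * Z ω, U ω) ∂μ = ∫ ω, X ω * G (X ω) (U ω) ∂μ := by
    have s1 : ∫ ω, X ω * F (X ω * Z ω, U ω) ∂μ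
        = ∫ p : (ℝ × β) × ℝ, p.1.1 * F (p.1.1 * p.2, p.1.2)
          ∂((Measure.map (fun ω => (X ω, U ω)) μ).prod P) := by
      rw [← hmap, integral_map (by fun_prop) hKm.aestronglyMeasurable]
    have s2 : Integrable (fun p : (ℝ × β) × ℝ => p.1.1 * F (p.1.1 * p.2, p.1.2))
        ((Measure.map (fun ω => (X ω, U ω)) μ).prod P) := by
      rw [← hmap, integrable_map_measure hKm.aestronglyMeasurable (by fun_prop)]
      apply aux_int
      · exact (hKm.comp (by fun_prop)).aestronglyMeasurable
      · refine ae_of_all _ fun ω => ?_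
        simp only [Function.comp, abs_mul]
        exact mul_le_one₀ (hb ω) (abs_nonneg _) (hFb _)
    rw [s1, integral_prod _ s2]
    simp_rw [integral_const_mul]
    rw [integral_map hXU.aemeasurable]
    exact (measurable_fst.mul hGm).aestronglyMeasurable
  have hA1 : Measurable (fun u => G 1 u) := hGm.comp (measurable_const.prodMk measurable_id)
  have hA2 : Measurable (fun u => G (-1) u) := hGm.comp (measurable_const.prodMk measurable_id)
  have hA : Measurable (fun u => (G 1 u + G (-1) u) / 2) := by fun_prop
  have hB : Measurable (fun u => (G 1 u - G (-1) u) / 2) := by fun_prop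
  have hAb : ∀ u, |(G 1 u + G (-1) u) / 2| ≤ 1 := fun u => by
    have := abs_le.1 (hGb 1 u)
    have := abs_le.1 (hGb (-1) u)
    rw [abs_le]; constructor <;> linarith
  have hBb : ∀ u, |(G 1 u - G (-1) u) / 2| ≤ 1 := fun u => by
    have := abs_le.1 (hGb 1 u)
    have := abs_le.1 (hGb (-1) u)
    rw [abs_le]; constructor <;> linarith
  have hBT : ∀ u, (G 1 u - G (-1) u) / 2 ≤ auxT P := fun u => by
    have := auxT_le P (fun y => F (y, u)) (by fun_prop) (fun y => hFb _)
    simpa [hG] using this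
  have hc := aux_bdd μ X U (ae_of_all _ hb)
  have hcm := aux_sm' μ X U hU
  have hAU : StronglyMeasurable[MeasurableSpace.comap U inferInstance]
      (fun ω => (G 1 (U ω) + G (-1) (U ω)) / 2) :=
    (hA.comp (comap_measurable U)).stronglyMeasurable
  have e2 := aux_mul μ X U hX hU (ae_of_all _ hb) _ hAU (ae_of_all _ fun ω => hAb _)
  have i1 : Integrable (fun ω => X ω * ((G 1 (U ω) + G (-1) (U ω)) / 2)) μ := by
    apply aux_int _ (fun ω => X ω * ((G 1 (U ω) + G (-1) (U ω)) / 2))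
      (hX.aestronglyMeasurable.mul (hA.comp hU).aestronglyMeasurable)
    refine ae_of_all _ fun ω => ?_
    rw [abs_mul]
    exact mul_le_one₀ (hb ω) (abs_nonneg _) (hAb _)
  have i2 : Integrable (fun ω => (G 1 (U ω) - G (-1) (U ω)) / 2) μ :=
    aux_int _ _ (hB.comp hU).aestronglyMeasurable (ae_of_all _ fun ω => hBb _)
  have i3 : Integrable (fun ω => condMean μ X U ω * ((G 1 (U ω) + G (-1) (U ω)) / 2)) μ := by
    apply aux_int _ (fun ω => condMean μ X U ω * ((G 1 (U ω) + G (-1) (U ω)) / 2))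
      (hcm.mul (hA.comp hU).aestronglyMeasurable)
    filter_upwards [hc] with ω h
    rw [abs_mul]
    exact mul_le_one₀ h (abs_nonneg _) (hAb _)
  have i4 : Integrable (fun ω => |condMean μ X U ω|) μ :=
    aux_int _ _ hcm.norm (by simpa using hc)
  have e3 : ∫ ω, X ω * G (X ω) (U ω) ∂μ
      = ∫ ω, (condMean μ X U ω * ((G 1 (U ω) + G (-1) (U ω)) / 2)
          + (G 1 (U ω) - G (-1) (U ω)) / 2) ∂μ := by
    rw [integral_add i3 i2, ← e2, ← integral_add i1 i2]
    congr 1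
    ext ω
    rcases hpm ω with h | h <;> rw [h] <;> ring
  rw [e1, e3]
  have e4 : auxT P + (∫ ω, |condMean μ X U ω| ∂μ) * (1 - auxT P)
      = ∫ ω, (auxT P + |condMean μ X U ω| * (1 - auxT P)) ∂μ := by
    rw [integral_add (integrable_const _) (i4.mul_const _), integral_mul_const]
    simp
  rw [e4]
  apply integral_mono_ae (i3.add i2) ((integrable_const _).add (i4.mul_const _))
  filter_upwards [hc] with ω h
  simp only [Pi.add_apply]
  have b1 := abs_le.1 (hGb 1 (U ω))
  have b2 := abs_le.1 (hGb (-1) (U ω))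
  have b3 := hBT (U ω)
  have b4 := mul_le_mul_of_nonneg_left b3 (sub_nonneg.2 h)
  rcases abs_cases (condMean μ X U ω) with ⟨h1, h2⟩ | ⟨h1, h2⟩
  · rw [h1] at b4 ⊢
    have := mul_le_mul_of_nonneg_left b1.2 h2
    linarith
  · rw [h1] at b4 ⊢
    have := mul_le_mul_of_nonneg_left b2.1 (neg_nonneg.2 h2.le)
    linarith

/-- for `X ∈ {±1}` observed through the BMS channel `Y = X·Z` (capacity
`C = Σ_k c_k q_k`) with side information `U` such that `Z` is independent of `(X, U)`,
`BER(X | Y, U) ≥ BER(X | Y) − √(ln 2 · (1 − C) · (1 − mmse(X|U)) / 2)`. -/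
theorem stmt_16 {Ω β : Type*} [MeasurableSpace Ω] [MeasurableSpace β]
    (μ : Measure Ω) [IsProbabilityMeasure μ]
    (X Z : Ω → ℝ) (U : Ω → β)
    (hX : Measurable X) (hZ : Measurable Z) (hU : Measurable U)
    (hpm : ∀ ω, X ω = -1 ∨ X ω = 1)
    (hindep : IndepFun (fun ω => (X ω, U ω)) Z μ) :
    BER μ X (fun ω => (X ω * Z ω, U ω))
      ≥ BER μ X (fun ω => X ω * Z ω)
        - Real.sqrt (Real.log 2
            * (1 - ∑' k : ℕ, ck (k + 1) * qmom (Measure.map Z μ) (k + 1))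
            * (1 - mmse μ X U) / 2) := by
  have hP : IsProbabilityMeasure (Measure.map Z μ) :=
    Measure.isProbabilityMeasure_map hZ.aemeasurable
  have hb : ∀ ω, |X ω| ≤ 1 := fun ω => by rcases hpm ω with h | h <;> simp [h]
  have h1 := aux_upper μ X Z U hX hZ hU hpm hindep
  have h2 := aux_lower μ X Z hX hZ hpm
  obtain ⟨q0, q1, q2, q3, q4⟩ := aux_q (Measure.map Z μ)
  have h3 := aux_tsum (qmom (Measure.map Z μ)) q0 q1
  have h4 := aux_mmse μ X U hX hU hpm
  have h5 := aux_sq μ (condMean μ X U) (aux_sm' μ X U hU) (aux_bdd μ X U (ae_of_all _ hb))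
  unfold BER
  rw [h4]
  set T := auxT (Measure.map Z μ)
  set a := ∫ ω, |condMean μ X U ω| ∂μ
  set s := ∫ ω, condMean μ X U ω ^ 2 ∂μ
  have hs : a * (1 - T) / 2 ≤ Real.sqrt (Real.log 2
      * (1 - ∑' k : ℕ, ck (k + 1) * qmom (Measure.map Z μ) (k + 1)) * s / 2) := by
    apply Real.le_sqrt_of_sq_le
    have hT : (1 - T) ^ 2 ≤ 1 - qmom (Measure.map Z μ) 1 := by nlinarith
    have hs0 : 0 ≤ s := le_trans (sq_nonneg a) h5
    have k1 : a ^ 2 * (1 - T) ^ 2 ≤ s * (1 - qmom (Measure.map Z μ) 1) :=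
      mul_le_mul h5 hT (sq_nonneg _) hs0
    have k2 := mul_le_mul_of_nonneg_right h3 hs0
    nlinarith
  linarith
end
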